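/- Let n ≥ 9, let S̃_n be Schur's double cover of S_n with projection π : S̃_n → S_n, and let g ∈ S̃_n be such that π(g) is an n-cycle. Then for every irreducible spin representation (ρ, V) of S̃_n, the minimal polynomial of the linear map ρ(g) equals X^n − ε_g; in particular ρ(g) has exactly n distinct eigenvalues. -/

import Mathlib

/-!
Schur's double cover `S̃_N` of the symmetric group, presented by generators
`z, t_1, …, t_{N-1}` and relations `z² = 1`, `t_i² = z`, `(t_i t_{i+1})³ = z`,
`(t_i t_j)² = z` for `|i − j| ≥ 2`.

Generators are indexed by `Option (Fin (N-1))`: `none` is the central element `z`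
and `some i` is `t_{i+1}` (so `some i` for `i = 0, …, N-2` are `t_1, …, t_{N-1}`).
-/

abbrev SchurGen (N : ℕ) := Option (Fin (N - 1))

namespace Schur

/-- The relator `z` as an element of the free group. -/
def zf (N : ℕ) : FreeGroup (SchurGen N) := FreeGroup.of none

/-- The generator `t_{i+1}` as an element of the free group. -/
def tf (N : ℕ) (i : Fin (N - 1)) : FreeGroup (SchurGen N) := FreeGroup.of (some i)

/-- The defining relators of Schur's double cover. -/
def rels (N : ℕ) : Set (FreeGroup (SchurGen N)) :=
  { r | r = zf N ^ 2 ∨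
        (∃ i, r = tf N i ^ 2 * (zf N)⁻¹) ∨
        (∃ i j : Fin (N - 1), (i : ℕ) + 1 = (j : ℕ) ∧
          r = (tf N i * tf N j) ^ 3 * (zf N)⁻¹) ∨
        (∃ i j : Fin (N - 1), ((i : ℕ) + 2 ≤ (j : ℕ) ∨ (j : ℕ) + 2 ≤ (i : ℕ)) ∧
          r = (tf N i * tf N j) ^ 2 * (zf N)⁻¹) }

/-- Schur's double cover `S̃_N` of the symmetric group `S_N`. -/
abbrev Cover (N : ℕ) := PresentedGroup (rels N)

/-- The central element `z` of `S̃_N`. -/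
def z (N : ℕ) : Cover N := PresentedGroup.of none

/-- The generator `t_{i+1}` of `S̃_N` (0-indexed). -/
def t (N : ℕ) (i : Fin (N - 1)) : Cover N := PresentedGroup.of (some i)

/-- The generator `t_i` of `S̃_N`, 1-indexed: meaningful for `1 ≤ i ≤ N-1`
(junk value `1` outside this range). -/
def T (N i : ℕ) : Cover N := if h : i - 1 < N - 1 then t N ⟨i - 1, h⟩ else 1

/-- The product `t_a t_{a+1} ⋯ t_{a+n-1}` (`n` consecutive generators, 1-indexed). -/
def P (N a n : ℕ) : Cover N := ((List.range n).map fun j => T N (a + j)).prod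

end Schur


/-- The adjacent transposition `(i, i+1)` of `{1, …, n}`: in 0-indexed terms, for
`i : Fin (n-1)` this is the swap of `i` and `i+1` in `Fin n`.  It is the image of the
generator `t_{i+1}` under the canonical projection `S̃_n → S_n`. -/
def Schur.adj (n : ℕ) (i : Fin (n - 1)) : Equiv.Perm (Fin n) :=
  Equiv.swap ⟨i.1, by have := i.2; omega⟩ ⟨i.1 + 1, by have := i.2; omega⟩

section spinRep

open Equiv Matrix
open scoped ComplexOrder

/-- A projective representation of the symmetric group on `α` by unitary matrices, given on a
group `G` over `Perm α`, in which lifts of transpositions square to `-1` and lifts of disjoint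
transpositions anticommute. -/
structure UnitarySpinRep (G α m : Type*) [Group G] [DecidableEq α] [Fintype m]
    [DecidableEq m] where
  π : G →* Perm α
  R : G →* Matrix m m ℂ
  surj : Function.Surjective π
  fiber : ∀ x y, π x = π y → R x = R y ∨ R x = -R y
  conjTranspose_R : ∀ x, (R x)ᴴ = R x⁻¹
  swap_sq : ∀ x a b, a ≠ b → π x = swap a b → R x * R x = -1
  swap_anticomm : ∀ x y a b c d, [a, b, c, d].Nodup → π x = swap a b → π y = swap c d →
    R x * R y = -(R y * R x)

namespace UnitarySpinRep

variable {G α m : Type*} [Group G] [DecidableEq α] [Fintype m] [DecidableEq m]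
  (D : UnitarySpinRep G α m)

lemma R_mul_inv (x : G) : D.R x * D.R x⁻¹ = 1 := by rw [← map_mul]; simp

lemma R_inv_mul (x : G) : D.R x⁻¹ * D.R x = 1 := by rw [← map_mul]; simp

lemma R_inv_mul_cancel_left (x : G) (A : Matrix m m ℂ) : D.R x⁻¹ * (D.R x * A) = A := by
  rw [← mul_assoc, R_inv_mul, one_mul]

omit [Fintype m] in
lemma one_ne_neg_one [Nonempty m] : (1 : Matrix m m ℂ) ≠ -1 := by
  intro h
  obtain ⟨i⟩ := ‹Nonempty m›
  have := congrFun (congrFun h i) i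
  norm_num at this

lemma R_ne_neg [Nonempty m] (x : G) : D.R x ≠ -D.R x := by
  intro h
  apply one_ne_neg_one (m := m)
  have := congrArg (· * D.R x⁻¹) h
  simpa [R_mul_inv] using this

lemma R_of_map_eq_one {x : G} (h : D.π x = 1) : D.R x = 1 ∨ D.R x = -1 := by
  simpa using D.fiber x 1 (by simpa using h)

lemma R_eq_of_odd_pow [Nonempty m] {x y : G} {d : ℕ} (hd : Odd d) (h : D.π x = D.π y)
    (hx : D.R x ^ d = D.R y ^ d) : D.R x = D.R y := by
  rcases D.fiber x y h with h | h
  · exact h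
  · rw [h, hd.neg_pow, ← map_pow] at hx
    exact absurd hx.symm (D.R_ne_neg _)

lemma R_conj_pow (s x : G) (d : ℕ) : D.R (s * x * s⁻¹) ^ d = D.R s * D.R x ^ d * D.R s⁻¹ := by
  rw [← map_pow, conj_pow, map_mul, map_mul, map_pow]

lemma R_conj_of_odd_pow [Nonempty m] {s x : G} {d : ℕ} (hd : Odd d) (hx : D.π x ^ d = 1)
    (hs : D.π s * D.π x = D.π x * D.π s) : D.R s * D.R x = D.R x * D.R s := by
  have h1 : D.R (s * x * s⁻¹) = D.R x := by
    apply D.R_eq_of_odd_pow hd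
    · simp [hs]
    · rw [R_conj_pow, ← map_pow]
      rcases D.R_of_map_eq_one (x := x ^ d) (by simpa using hx) with h | h <;>
        simp [h, R_mul_inv]
  have h2 := congrArg (· * D.R s) h1
  simpa only [map_mul, mul_assoc, R_inv_mul, mul_one] using h2

lemma exists_lift_pow_three {σ : Perm α} (h : σ ^ 3 = 1) : ∃ x, D.π x = σ ∧ D.R x ^ 3 = 1 := by
  obtain ⟨x, rfl⟩ := D.surj σ
  refine ⟨x ^ 4, ?_, ?_⟩
  · rw [map_pow, pow_succ, h, one_mul]
  · rw [map_pow, ← pow_mul, mul_comm, pow_mul, ← map_pow]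
    rcases D.R_of_map_eq_one (x := x ^ 3) (by simpa using h) with h | h <;> simp [h]
    norm_num

/-- The three-cycle `a ↦ b ↦ c ↦ a`. -/
def cyc (a b c : α) : Perm α := swap a b * swap b c

omit [Fintype m] [DecidableEq m] in
lemma cyc_conj (w : Perm α) (a b c : α) : w * cyc a b c * w⁻¹ = cyc (w a) (w b) (w c) := by
  simp only [cyc, Equiv.swap_apply_apply]; group

end UnitarySpinRep

/-- A linear functional on matrices that is nonnegative on the positive matrices. -/
def PosFunctional {m : Type*} [Fintype m] (τ : Matrix m m ℂ →ₗ[ℂ] ℂ) : Prop :=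
  ∀ A, 0 ≤ τ (Aᴴ * A)

namespace PosFunctional

variable {m : Type*} [Fintype m] [DecidableEq m] {τ : Matrix m m ℂ →ₗ[ℂ] ℂ}

omit [DecidableEq m] in
lemma im_sq (hτ : PosFunctional τ) (A : Matrix m m ℂ) : (τ (Aᴴ * A)).im = 0 :=
  (Complex.le_def.1 (hτ A)).2.symm

omit [DecidableEq m] in
lemma re_sq (hτ : PosFunctional τ) (A : Matrix m m ℂ) : 0 ≤ (τ (Aᴴ * A)).re :=
  (Complex.le_def.1 (hτ A)).1

lemma im_one (hτ : PosFunctional τ) : (τ 1).im = 0 := by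
  simpa using hτ.im_sq 1

lemma im_eq_zero (hτ : PosFunctional τ) {A : Matrix m m ℂ} (hA : Aᴴ = A) : (τ A).im = 0 := by
  have h1 := hτ.im_sq (1 + A)
  have h2 := hτ.im_sq A
  simp only [conjTranspose_add, conjTranspose_one, hA, add_mul, mul_add, one_mul, mul_one,
    map_add, Complex.add_im, hτ.im_one] at h1 h2
  linarith

lemma map_conjTranspose (hτ : PosFunctional τ) (A : Matrix m m ℂ) :
    τ Aᴴ = starRingEnd ℂ (τ A) := by
  have h1 := hτ.im_eq_zero (A := A + Aᴴ) (by simp [add_comm])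
  have h2 := hτ.im_eq_zero (A := Complex.I • (A - Aᴴ)) (by
    simp only [conjTranspose_smul, conjTranspose_sub, conjTranspose_conjTranspose,
      Complex.star_def, Complex.conj_I, neg_smul, ← smul_neg, neg_sub])
  simp only [map_add, map_smul, map_sub, smul_eq_mul, Complex.add_im, Complex.mul_im,
    Complex.I_re, Complex.I_im, Complex.sub_re, Complex.sub_im] at h1 h2
  apply Complex.ext <;> simp <;> linarith

lemma norm_le (hτ : PosFunctional τ) {B : Matrix m m ℂ} {δ : ℝ} (hδ : 0 < δ)
    (hB : Bᴴ * B = ((δ : ℂ) ^ 2) • (1 : Matrix m m ℂ)) : ‖τ B‖ ≤ δ * (τ 1).re := by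
  obtain ⟨c, hc, hcB⟩ : ∃ c : ℂ, starRingEnd ℂ c * c = 1 ∧ c * τ B = ‖τ B‖ := by
    rcases eq_or_ne (τ B) 0 with h | h
    · exact ⟨1, by simp, by simp [h]⟩
    · have hn : (‖τ B‖ : ℂ) ≠ 0 := by simpa using h
      refine ⟨starRingEnd ℂ (τ B) / ‖τ B‖, ?_, ?_⟩
      · simp only [map_div₀, Complex.conj_conj, Complex.conj_ofReal]
        field_simp
        rw [Complex.mul_conj']
      · rw [div_mul_eq_mul_div, Complex.conj_mul']
        field_simp
  have h := hτ.re_sq ((δ : ℂ) • 1 - c • B)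
  have hexp : ((δ : ℂ) • (1 : Matrix m m ℂ) - c • B)ᴴ * ((δ : ℂ) • 1 - c • B)
      = (2 * (δ : ℂ) ^ 2) • 1 - (δ : ℂ) • (c • B + (c • B)ᴴ) := by
    have h1 : (c • B)ᴴ * (c • B) = ((δ : ℂ) ^ 2) • (1 : Matrix m m ℂ) := by
      rw [conjTranspose_smul, smul_mul_assoc, mul_smul_comm, hB, smul_smul, Complex.star_def, hc,
        one_smul]
    rw [conjTranspose_sub, sub_mul, mul_sub, mul_sub, h1]
    simp only [conjTranspose_smul, conjTranspose_one, Complex.star_def, Complex.conj_ofReal,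
      smul_mul_assoc, mul_smul_comm, mul_one, one_mul, smul_add, two_mul, add_smul, smul_smul, sq,
      mul_comm c]
    abel
  rw [hexp] at h
  simp only [map_sub, map_smul, map_add, hτ.map_conjTranspose, smul_eq_mul, hcB,
    Complex.conj_ofReal] at h
  have h2 : (2 * (δ : ℂ) ^ 2 * τ 1 - δ * ((‖τ B‖ : ℂ) + ‖τ B‖)).re
      = 2 * δ * (δ * (τ 1).re - ‖τ B‖) := by
    have e1 : (2 * (δ : ℂ) ^ 2) = ((2 * δ ^ 2 : ℝ) : ℂ) := by push_cast; ring
    rw [e1, ← Complex.ofReal_add, ← Complex.ofReal_mul, Complex.sub_re, Complex.re_ofReal_mul,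
      Complex.ofReal_re]
    ring
  rw [h2] at h
  have := (mul_nonneg_iff_of_pos_left (by positivity)).1 h
  linarith

/-- The functional `x ↦ τ (D x D)`. -/
def compress (τ : Matrix m m ℂ →ₗ[ℂ] ℂ) (D : Matrix m m ℂ) : Matrix m m ℂ →ₗ[ℂ] ℂ :=
  τ ∘ₗ LinearMap.mulLeft ℂ D ∘ₗ LinearMap.mulRight ℂ D

lemma compress_apply (D x : Matrix m m ℂ) : compress τ D x = τ (D * (x * D)) := rfl

lemma compress_pos (hτ : PosFunctional τ) {D : Matrix m m ℂ} (hD : Dᴴ = D) :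
    PosFunctional (compress τ D) := by
  intro A
  have := hτ (A * D)
  rwa [conjTranspose_mul, hD, mul_assoc, ← mul_assoc Aᴴ] at this

/-- Polarization: a bound for the compressions of `τ` at `h` gives a bound at `h * A * Y`. -/
lemma norm_le_of_compress {h A Y : Matrix m m ℂ}
    (hAY : A * Y = Y * A) (hhA : h * A = A * h) (hhY : h * Y = Y * h)
    {a s : ℝ} (hs : 0 < s)
    (H : ∀ α β : ℝ, ‖compress τ ((α : ℂ) • A + (β : ℂ) • Y) h‖
      ≤ a * (compress τ ((α : ℂ) • A + (β : ℂ) • Y) 1).re) :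
    ‖τ (h * (A * Y))‖ ≤ a / 2 * (s * (τ (A * A)).re + (τ (Y * Y)).re / s) := by
  have key : ∀ α β : ℝ, ∀ x : Matrix m m ℂ, x * A = A * x → x * Y = Y * x →
      compress τ ((α : ℂ) • A + (β : ℂ) • Y) x
      = ((α * α : ℝ) : ℂ) * τ (x * (A * A)) + ((2 * α * β : ℝ) : ℂ) * τ (x * (A * Y))
        + ((β * β : ℝ) : ℂ) * τ (x * (Y * Y)) := by
    intro α β x hxA hxY
    have e1 : A * (x * A) = x * (A * A) := by rw [← mul_assoc, ← hxA, mul_assoc]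
    have e2 : A * (x * Y) = x * (A * Y) := by rw [← mul_assoc, ← hxA, mul_assoc]
    have e3 : Y * (x * A) = x * (A * Y) := by rw [← mul_assoc, ← hxY, mul_assoc, hAY]
    have e4 : Y * (x * Y) = x * (Y * Y) := by rw [← mul_assoc, ← hxY, mul_assoc]
    rw [compress_apply]
    simp only [add_mul, mul_add, smul_mul_assoc, mul_smul_comm, map_add, map_smul, smul_eq_mul,
      e1, e2, e3, e4]
    push_cast
    ring
  have hss := Real.mul_self_sqrt hs.le
  have hsp := Real.sqrt_pos.2 hs
  set r := Real.sqrt s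
  have h1 := H r (1 / r)
  have h2 := H r (-(1 / r))
  rw [key _ _ _ hhA hhY, key _ _ 1 (by simp) (by simp)] at h1 h2
  have hr : r * (1 / r) = 1 := by field_simp
  have hi : 1 / r * (1 / r) = 1 / s := by rw [← hss]; field_simp
  have a1 : 2 * r * (1 / r) = 2 := by rw [mul_assoc, hr, mul_one]
  have a2 : 2 * r * (-(1 / r)) = -2 := by rw [mul_neg, a1]
  rw [hss, hi, a1] at h1
  rw [hss, neg_mul_neg, hi, a2] at h2
  simp only [one_mul, Complex.add_re, Complex.re_ofReal_mul] at h1 h2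
  have e : (4 : ℂ) * τ (h * (A * Y)) =
      ((s : ℂ) * τ (h * (A * A)) + ((2 : ℝ) : ℂ) * τ (h * (A * Y))
        + ((1 / s : ℝ) : ℂ) * τ (h * (Y * Y)))
      - ((s : ℂ) * τ (h * (A * A)) + ((-2 : ℝ) : ℂ) * τ (h * (A * Y))
        + ((1 / s : ℝ) : ℂ) * τ (h * (Y * Y))) := by push_cast; ring
  have h3 := norm_sub_le ((s : ℂ) * τ (h * (A * A)) + ((2 : ℝ) : ℂ) * τ (h * (A * Y))
        + ((1 / s : ℝ) : ℂ) * τ (h * (Y * Y))) ((s : ℂ) * τ (h * (A * A))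
        + ((-2 : ℝ) : ℂ) * τ (h * (A * Y)) + ((1 / s : ℝ) : ℂ) * τ (h * (Y * Y)))
  rw [← e, norm_mul] at h3
  have h4 : ‖(4 : ℂ)‖ = 4 := by norm_num
  rw [h4] at h3
  have : (τ (Y * Y)).re / s = 1 / s * (τ (Y * Y)).re := by ring
  rw [this]
  linarith

end PosFunctional

namespace UnitarySpinRep

section cycles

variable {α : Type*} [DecidableEq α]

lemma cyc_pow_three {a b c : α} (hab : a ≠ b) (hac : a ≠ c) (hbc : b ≠ c) :
    cyc a b c ^ 3 = 1 := by
  ext x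
  simp only [cyc, pow_succ, pow_zero, one_mul, Perm.mul_apply, Perm.one_apply, swap_apply_def]
  grind

lemma cyc_inv (a b c : α) (hab : a ≠ b) (hac : a ≠ c) (hbc : b ≠ c) :
    (cyc a b c)⁻¹ = cyc b a c := by
  ext x
  simp only [cyc, _root_.mul_inv_rev, swap_inv, Perm.mul_apply, swap_apply_def]
  grind

lemma cyc_mul_cyc {a b c d : α} (h : [a, b, c, d].Nodup) :
    cyc a b c * cyc a b d = swap a c * swap b d := by
  ext x
  simp only [List.nodup_cons, List.mem_cons, not_or] at h
  simp only [cyc, Perm.mul_apply, swap_apply_def]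
  grind

/-- The permutations fixing `c` pointwise and mapping `l` into itself. -/
def Admissible (c l : Finset α) (w : Perm α) : Prop :=
  (∀ x ∈ c, w x = x) ∧ ∀ x ∈ l, w x ∈ l

omit [DecidableEq α] in
lemma Admissible.mul {c l : Finset α} {v w : Perm α} (hv : Admissible c l v)
    (hw : Admissible c l w) : Admissible c l (v * w) :=
  ⟨fun x hx => by rw [Perm.mul_apply, hw.1 x hx, hv.1 x hx],
    fun x hx => hv.2 _ (hw.2 _ hx)⟩

omit [DecidableEq α] in
lemma Admissible.pow {c l : Finset α} {w : Perm α} (hw : Admissible c l w) (k : ℕ) :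
    Admissible c l (w ^ k) := by
  induction k with
  | zero => exact ⟨fun _ _ => rfl, fun _ h => h⟩
  | succ k ih => rw [pow_succ]; exact ih.mul hw

lemma Admissible.swap {c l : Finset α} (hd : Disjoint c l) {a b : α} (ha : a ∈ l) (hb : b ∈ l) :
    Admissible c l (Equiv.swap a b) := by
  constructor
  · intro x hx
    have := Finset.disjoint_left.1 hd hx
    rw [swap_apply_of_ne_of_ne] <;> rintro rfl <;> contradiction
  · intro x hx
    rw [swap_apply_def]
    split_ifs <;> assumption

lemma Admissible.cyc {c l : Finset α} (hd : Disjoint c l) {a b p : α} (ha : a ∈ l) (hb : b ∈ l)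
    (hp : p ∈ l) : Admissible c l (cyc a b p) :=
  (Admissible.swap hd ha hb).mul (Admissible.swap hd hb hp)

end cycles

variable {G α m : Type*} [Group G] [DecidableEq α] [Fintype m] [DecidableEq m]
  (D : UnitarySpinRep G α m)

open Classical in
/-- The matrix of the lift of order three of the three-cycle `a ↦ b ↦ c ↦ a`. -/
noncomputable def M (a b c : α) : Matrix m m ℂ :=
  if h : cyc a b c ^ 3 = 1 then D.R (D.exists_lift_pow_three h).choose else 1

section M

variable {a b c : α} (hab : a ≠ b) (hac : a ≠ c) (hbc : b ≠ c)
include hab hac hbc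

lemma exists_M : ∃ x, D.π x = cyc a b c ∧ D.R x ^ 3 = 1 ∧ D.M a b c = D.R x := by
  have h := cyc_pow_three hab hac hbc
  refine ⟨(D.exists_lift_pow_three h).choose, (D.exists_lift_pow_three h).choose_spec.1,
    (D.exists_lift_pow_three h).choose_spec.2, ?_⟩
  rw [M, dif_pos h]

lemma M_eq [Nonempty m] {x : G} (hx : D.π x = cyc a b c) (h3 : D.R x ^ 3 = 1) :
    D.M a b c = D.R x := by
  obtain ⟨y, hy, hy3, hM⟩ := D.exists_M hab hac hbc
  rw [hM]
  exact D.R_eq_of_odd_pow (d := 3) (by decide) (hy.trans hx.symm) (hy3.trans h3.symm)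

lemma M_conj [Nonempty m] (w : G) :
    D.R w * D.M a b c * D.R w⁻¹ = D.M (D.π w a) (D.π w b) (D.π w c) := by
  obtain ⟨y, hy, hy3, hM⟩ := D.exists_M hab hac hbc
  rw [D.M_eq (a := D.π w a) (x := w * y * w⁻¹) (by simpa using hab) (by simpa using hac) (by simpa using hbc)]
  · simp [hM]
  · rw [map_mul, map_mul, hy, map_inv, cyc_conj]
  · rw [R_conj_pow, hy3, mul_one, R_mul_inv]

lemma M_conjTranspose [Nonempty m] : (D.M a b c)ᴴ = D.M b a c := by
  obtain ⟨y, hy, hy3, hM⟩ := D.exists_M hab hac hbc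
  rw [hM, D.conjTranspose_R, D.M_eq hab.symm hbc hac]
  · rw [map_inv, hy, cyc_inv _ _ _ hab hac hbc]
  · rw [← map_pow, inv_pow, ← D.conjTranspose_R, map_pow, hy3, conjTranspose_one]

lemma M_conjTranspose_mul : (D.M a b c)ᴴ * D.M a b c = 1 := by
  obtain ⟨y, hy, hy3, hM⟩ := D.exists_M hab hac hbc
  rw [hM, D.conjTranspose_R, R_inv_mul]

lemma M_mul_conjTranspose : D.M a b c * (D.M a b c)ᴴ = 1 := by
  obtain ⟨y, hy, hy3, hM⟩ := D.exists_M hab hac hbc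
  rw [hM, D.conjTranspose_R, R_mul_inv]

lemma M_sq : D.M a b c * D.M a b c = (D.M a b c)ᴴ := by
  obtain ⟨y, hy, hy3, hM⟩ := D.exists_M hab hac hbc
  have h : D.M a b c * D.M a b c * D.M a b c = 1 := by
    rw [hM, ← pow_two, ← pow_succ, hy3]
  rw [← mul_one (_ * _), ← D.M_mul_conjTranspose hab hac hbc, ← mul_assoc, h, one_mul]

end M

lemma swap_pair_sq {x y : G} {a b c d : α} (h : [a, b, c, d].Nodup) (hx : D.π x = swap a b)
    (hy : D.π y = swap c d) : D.R (x * y) * D.R (x * y) = -1 := by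
  have hn := h
  simp only [List.nodup_cons, List.mem_cons, not_or] at hn
  have h1 := D.swap_sq x a b hn.1.1 hx
  have h2 := D.swap_sq y c d hn.2.2.1.1 hy
  have h3 := D.swap_anticomm x y a b c d h hx hy
  rw [map_mul, mul_assoc, ← mul_assoc (D.R y), ← neg_eq_iff_eq_neg.2 h3, neg_mul, mul_neg,
    ← mul_assoc, ← mul_assoc, h1, mul_assoc, h2]
  simp

lemma exists_swap_pair_conj {z : G} {a b c d : α} (h : [a, b, c, d].Nodup)
    (hz : D.π z = swap a b * swap c d) :
    D.R z * D.R z = -1 ∧ ∀ s, D.π s = swap a b → D.R s * D.R z * D.R s⁻¹ = -D.R z := by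
  obtain ⟨x, hx⟩ := D.surj (swap a b)
  obtain ⟨y, hy⟩ := D.surj (swap c d)
  have hn := h
  simp only [List.nodup_cons, List.mem_cons, not_or] at hn
  have hxy : D.R x * D.R (x * y) * D.R x⁻¹ = -D.R (x * y) := by
    have := D.swap_anticomm x y a b c d h hx hy
    rw [map_mul, this, mul_neg, neg_mul, ← mul_assoc, mul_assoc, R_mul_inv, mul_one, this]
  have hs : ∀ s, D.π s = swap a b → D.R s * D.R (x * y) * D.R s⁻¹ = -D.R (x * y) := by
    intro s hs
    have h1 : D.R s⁻¹ = (D.R s)ᴴ := (D.conjTranspose_R s).symm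
    rw [← hxy, h1, ← D.conjTranspose_R x]
    rcases D.fiber s x (hs.trans hx.symm) with e | e <;> simp [e]
  rcases D.fiber z (x * y) (by rw [hz, map_mul, hx, hy]) with e | e
  · rw [e]; exact ⟨D.swap_pair_sq h hx hy, hs⟩
  · rw [e]
    refine ⟨by rw [neg_mul_neg]; exact D.swap_pair_sq h hx hy, fun s h => ?_⟩
    rw [mul_neg, neg_mul, hs s h]

/-- Invariance of `τ` under conjugation by lifts of the permutations admissible for `c`, `l`. -/
def Tracial (τ : Matrix m m ℂ →ₗ[ℂ] ℂ) (c l : Finset α) : Prop :=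
  ∀ w, Admissible c l (D.π w) → ∀ A, τ (D.R w * A * D.R w⁻¹) = τ A

section functional

variable {D} [Nonempty m] {τ : Matrix m m ℂ →ₗ[ℂ] ℂ} {c l : Finset α} (hτ : PosFunctional τ)
  (ht : D.Tracial τ c l) (hd : Disjoint c l)

include ht in
lemma Tracial.map_M {a b q : α} (hab : a ≠ b) (hac : a ≠ q) (hbc : b ≠ q) {w : Perm α}
    (hw : Admissible c l w) : τ (D.M (w a) (w b) (w q)) = τ (D.M a b q) := by
  obtain ⟨x, rfl⟩ := D.surj w
  rw [← D.M_conj hab hac hbc, ht x hw]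

include ht hd in
lemma Tracial.map_M_swap {a b q : α} (hab : a ≠ b) (haq : a ≠ q) (hbq : b ≠ q)
    (ha : a ∈ l) (hb : b ∈ l) : τ (D.M b a q) = τ (D.M a b q) := by
  have := ht.map_M hab haq hbq (Admissible.swap hd ha hb)
  rwa [swap_apply_left, swap_apply_right, swap_apply_of_ne_of_ne haq.symm hbq.symm] at this

include ht hd in
lemma Tracial.map_M_third {a b q q' : α} (hab : a ≠ b) (haq : a ≠ q) (hbq : b ≠ q)
    (haq' : a ≠ q') (hbq' : b ≠ q')
    (hq : q ∈ l) (hq' : q' ∈ l) : τ (D.M a b q') = τ (D.M a b q) := by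
  have := ht.map_M hab haq hbq (Admissible.swap hd hq hq')
  rwa [swap_apply_left, swap_apply_of_ne_of_ne haq haq',
    swap_apply_of_ne_of_ne hbq hbq'] at this

include ht hd in
omit [Nonempty m] in
lemma Tracial.map_M_mul_M {a b q q' : α} (h : [a, b, q, q'].Nodup) (ha : a ∈ l) (hq : q ∈ l) :
    τ (D.M a b q * D.M a b q') = 0 := by
  have hn := h
  simp only [List.nodup_cons, List.mem_cons, not_or, List.not_mem_nil, not_false_eq_true,
    and_true] at hn
  obtain ⟨x, hx, -, hM⟩ := D.exists_M hn.1.1 hn.1.2.1 hn.2.1.1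
  obtain ⟨y, hy, -, hM'⟩ := D.exists_M hn.1.1 hn.1.2.2 hn.2.1.2
  rw [hM, hM', ← map_mul]
  obtain ⟨s, hs⟩ := D.surj (swap a q)
  have h1 := (D.exists_swap_pair_conj (z := x * y) (a := a) (b := q) (c := b) (d := q')
    (by grind) (by rw [map_mul, hx, hy, cyc_mul_cyc h])).2 s hs
  have h2 := ht s (hs ▸ Admissible.swap hd ha hq) (D.R (x * y))
  rw [h1, map_neg] at h2
  exact CharZero.neg_eq_self_iff.1 h2

include ht hd in
lemma Tracial.map_M_mul_M_conjTranspose {a b q q' : α} (h : [a, b, q, q'].Nodup) (ha : a ∈ l)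
    (hb : b ∈ l) (hq : q ∈ l) (hq' : q' ∈ l) :
    τ (D.M a b q * (D.M a b q')ᴴ) = -τ (D.M a b q) := by
  have hn := h
  simp only [List.nodup_cons, List.mem_cons, not_or, List.not_mem_nil, not_false_eq_true,
    and_true] at hn
  obtain ⟨x, hx, -, hM⟩ := D.exists_M hn.1.1 hn.1.2.1 hn.2.1.1
  obtain ⟨y, hy, -, hM'⟩ := D.exists_M hn.1.1 hn.1.2.2 hn.2.1.2
  have h1 := (D.exists_swap_pair_conj (z := x * y) (a := a) (b := q) (c := b) (d := q')
    (by grind) (by rw [map_mul, hx, hy, cyc_mul_cyc h])).1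
  have hsq := D.M_sq hn.1.1 hn.1.2.1 hn.2.1.1
  have hinv := D.M_conjTranspose_mul hn.1.1 hn.1.2.1 hn.2.1.1
  rw [map_mul, ← hM, ← hM'] at h1
  have h2 : D.M a b q * (D.M a b q')ᴴ = -((D.M a b q)ᴴ * (D.M a b q' * D.M a b q)) := by
    have h3 : (D.M a b q')ᴴ = -(D.M a b q * D.M a b q' * D.M a b q) := by
      have := congrArg (· * (D.M a b q')ᴴ) h1
      simp only [mul_assoc, D.M_mul_conjTranspose hn.1.1 hn.1.2.2 hn.2.1.2, neg_mul, one_mul,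
        mul_one] at this
      rw [mul_assoc, this, neg_neg]
    rw [h3, mul_neg, ← hsq]
    simp only [mul_assoc]
  rw [h2, map_neg]
  congr 1
  have h4 := ht x⁻¹ (by
    rw [map_inv, hx, cyc_inv _ _ _ hn.1.1 hn.1.2.1 hn.2.1.1]
    exact Admissible.cyc hd hb ha hq) (D.M a b q')
  rw [inv_inv, ← D.conjTranspose_R, ← hM, mul_assoc] at h4
  rw [h4]
  exact ht.map_M_third hd hn.1.1 hn.1.2.1 hn.2.1.1 hn.1.2.2 hn.2.1.2 hq hq'

end functional

end UnitarySpinRep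

namespace UnitarySpinRep

variable {G α m : Type*} [Group G] [DecidableEq α] [Fintype m] [DecidableEq m]
  (D : UnitarySpinRep G α m)

/-- The sum of the order-three lifts of the three-cycles `a ↦ b ↦ q ↦ a` with `q ∈ s`. -/
noncomputable def cycSum (a b : α) (s : Finset α) : Matrix m m ℂ := ∑ q ∈ s, D.M a b q

section cycSum

variable {D} [Nonempty m] {a b : α} {s : Finset α} (hab : a ≠ b) (ha : a ∉ s) (hb : b ∉ s)
include hab ha hb

lemma cycSum_conjTranspose : (D.cycSum a b s)ᴴ = D.cycSum b a s := by
  rw [cycSum, conjTranspose_sum]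
  refine Finset.sum_congr rfl fun q hq => D.M_conjTranspose hab ?_ ?_ <;> grind

lemma cycSum_conj_swap {x : G} (hx : D.π x = swap a b) :
    D.R x * D.cycSum a b s * D.R x⁻¹ = D.cycSum b a s := by
  rw [cycSum, Finset.mul_sum, Finset.sum_mul]
  refine Finset.sum_congr rfl fun q hq => ?_
  rw [D.M_conj hab (by grind) (by grind), hx, swap_apply_left, swap_apply_right,
    swap_apply_of_ne_of_ne (by grind) (by grind)]

lemma cycSum_conj {x : G} (hxa : D.π x a = a) (hxb : D.π x b = b) (hxs : ∀ q ∈ s, D.π x q ∈ s) :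
    D.R x * D.cycSum a b s = D.cycSum a b s * D.R x := by
  have h : D.R x * D.cycSum a b s * D.R x⁻¹ = D.cycSum a b s := by
    rw [cycSum, Finset.mul_sum, Finset.sum_mul]
    have himg : s.image (D.π x) = s :=
      Finset.eq_of_subset_of_card_le (by intro q; simp only [Finset.mem_image]; grind)
        (Finset.card_image_of_injective s (D.π x).injective).ge
    conv_rhs => rw [← himg, Finset.sum_image (fun _ _ _ _ h => (D.π x).injective h)]
    refine Finset.sum_congr rfl fun q hq => ?_
    rw [D.M_conj hab (by grind) (by grind), hxa, hxb]
  have h2 := congrArg (· * D.R x) h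
  simpa only [mul_assoc, R_inv_mul, mul_one] using h2

variable {τ : Matrix m m ℂ →ₗ[ℂ] ℂ} {c l : Finset α}
  (ht : D.Tracial τ c l) (hd : Disjoint c l) (hal : a ∈ l) (hbl : b ∈ l) (hsl : s ⊆ l)
include ht hd hal hbl hsl

lemma Tracial.map_cycSum_sq {T : ℂ} (hT : ∀ q ∈ s, τ (D.M a b q) = T) :
    τ (D.cycSum a b s * D.cycSum a b s) = s.card * T := by
  rw [cycSum, Finset.sum_mul_sum, map_sum, Finset.sum_congr rfl (g := fun _ => T), Finset.sum_const,
    nsmul_eq_mul]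
  intro q hq
  have haq : a ≠ q := by grind
  have hbq : b ≠ q := by grind
  rw [map_sum, Finset.sum_eq_single_of_mem q hq]
  · rw [D.M_sq hab haq hbq, D.M_conjTranspose hab haq hbq,
      ht.map_M_swap hd hab haq hbq hal hbl, hT q hq]
  · intro q' hq' hne
    exact ht.map_M_mul_M hd (by grind) hal (hsl hq)

lemma Tracial.map_cycSum_mul_conjTranspose {T : ℂ} (hT : ∀ q ∈ s, τ (D.M a b q) = T) :
    τ (D.cycSum a b s * (D.cycSum a b s)ᴴ) = s.card * τ 1 - s.card * (s.card - 1) * T := by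
  rw [cycSum, conjTranspose_sum, Finset.sum_mul_sum, map_sum,
    Finset.sum_congr rfl (g := fun _ => τ 1 - (s.card - 1) * T), Finset.sum_const,
    nsmul_eq_mul]
  · ring
  intro q hq
  have haq : a ≠ q := by grind
  have hbq : b ≠ q := by grind
  rw [map_sum, ← Finset.add_sum_erase _ _ hq, D.M_mul_conjTranspose hab haq hbq,
    Finset.sum_congr rfl (g := fun _ => -T), Finset.sum_const, Finset.card_erase_of_mem hq,
    nsmul_eq_mul, Nat.cast_pred (Finset.card_pos.2 ⟨q, hq⟩)]
  · ring
  · intro q' hq'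
    rw [ht.map_M_mul_M_conjTranspose hd (by grind) hal hbl (hsl hq) (hsl (by grind)), hT q hq]

omit ha hb hsl in
lemma Tracial.exists_map_M_eq (hτ : PosFunctional τ) {q : α} (haq : a ≠ q) (hbq : b ≠ q) :
    ∃ T : ℝ, τ (D.M a b q) = T ∧ -(τ 1).re / 2 ≤ T ∧ T ≤ (τ 1).re := by
  have hreal : starRingEnd ℂ (τ (D.M a b q)) = τ (D.M a b q) := by
    rw [← hτ.map_conjTranspose, D.M_conjTranspose hab haq hbq,
      ht.map_M_swap hd hab haq hbq hal hbl]
  obtain ⟨T, hT⟩ := Complex.conj_eq_iff_real.1 hreal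
  refine ⟨T, hT, ?_, ?_⟩
  · have h := hτ.re_sq (1 + D.M a b q + (D.M a b q)ᴴ)
    have e : (1 + D.M a b q + (D.M a b q)ᴴ)ᴴ * (1 + D.M a b q + (D.M a b q)ᴴ)
        = (3 : ℂ) • (1 + D.M a b q + (D.M a b q)ᴴ) := by
      have h2 : (D.M a b q)ᴴ * (D.M a b q)ᴴ = D.M a b q := by
        rw [← conjTranspose_mul, D.M_sq hab haq hbq, conjTranspose_conjTranspose]
      simp only [conjTranspose_add, conjTranspose_one, conjTranspose_conjTranspose, mul_add,
        add_mul, one_mul, mul_one, D.M_sq hab haq hbq, h2, D.M_conjTranspose_mul hab haq hbq,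
        D.M_mul_conjTranspose hab haq hbq]
      module
    rw [e, map_smul, map_add, map_add, hτ.map_conjTranspose, hT, Complex.conj_ofReal,
      smul_eq_mul] at h
    simp at h
    linarith
  · have h := hτ.norm_le (B := D.M a b q) one_pos
      (by simp [D.M_conjTranspose_mul hab haq hbq])
    rw [hT, one_mul, Complex.norm_real, Real.norm_eq_abs] at h
    exact (le_abs_self T).trans h

end cycSum

/-- The normalized hermitian part of `ι • cycSum a b s`. -/
noncomputable def hermSum (ι : ℂ) (a b : α) (s : Finset α) : Matrix m m ℂ :=
  ((2 * s.card : ℂ)⁻¹) • (ι • D.cycSum a b s + (starRingEnd ℂ ι) • (D.cycSum a b s)ᴴ)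

section hermSum

variable {D} [Nonempty m] {a b : α} {s : Finset α} {ι : ℂ}

omit [Nonempty m] in
lemma hermSum_conjTranspose : (D.hermSum ι a b s)ᴴ = D.hermSum ι a b s := by
  simp only [hermSum, conjTranspose_smul, conjTranspose_add, conjTranspose_conjTranspose,
    Complex.star_def, Complex.conj_conj, map_inv₀, map_mul, map_ofNat, map_natCast]
  rw [add_comm]

lemma hermSum_comm (hab : a ≠ b) (ha : a ∉ s) (hb : b ∉ s) {x : G} (hxa : D.π x a = a)
    (hxb : D.π x b = b) (hxs : ∀ q ∈ s, D.π x q ∈ s) :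
    D.R x * D.hermSum ι a b s = D.hermSum ι a b s * D.R x := by
  have h1 := cycSum_conj hab ha hb hxa hxb hxs
  have h2 := cycSum_conj hab.symm hb ha hxb hxa hxs
  rw [← cycSum_conjTranspose hab ha hb] at h2
  simp only [hermSum, mul_smul_comm, smul_mul_assoc, mul_add, add_mul, h1, h2]

lemma Tracial.map_hermSum_sq (hab : a ≠ b) (ha : a ∉ s) (hb : b ∉ s) (hs : s.Nonempty)
    {τ : Matrix m m ℂ →ₗ[ℂ] ℂ} {c l : Finset α}
    (ht : D.Tracial τ c l) (hd : Disjoint c l) (hal : a ∈ l) (hbl : b ∈ l) (hsl : s ⊆ l)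
    (hτ : PosFunctional τ) {η T : ℝ} (hη : ι ^ 2 = η) (hn : starRingEnd ℂ ι * ι = 1)
    (hT : ∀ q ∈ s, τ (D.M a b q) = T) :
    (τ (D.hermSum ι a b s * D.hermSum ι a b s)).re
      = ((τ 1).re + η * T - (s.card - 1) * T) / (2 * s.card) := by
  have hT' : ∀ q ∈ s, τ (D.M b a q) = T := fun q hq => by
    rw [ht.map_M_swap hd hab (by grind) (by grind) hal hbl, hT q hq]
  have h1 := ht.map_cycSum_sq hab ha hb hd hal hbl hsl hT
  have h2 := ht.map_cycSum_mul_conjTranspose hab ha hb hd hal hbl hsl hT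
  have h3 := ht.map_cycSum_sq hab.symm hb ha hd hbl hal hsl hT'
  have h4 := ht.map_cycSum_mul_conjTranspose hab.symm hb ha hd hbl hal hsl hT'
  have h5 := cycSum_conjTranspose (D := D) hab ha hb
  rw [← h5] at h3 h4
  rw [conjTranspose_conjTranspose] at h4
  have hcη : (starRingEnd ℂ ι) ^ 2 = η := by rw [← map_pow, hη, Complex.conj_ofReal]
  have hn' : ι * starRingEnd ℂ ι = 1 := by rw [mul_comm, hn]
  have hr : (s.card : ℂ) ≠ 0 := by exact_mod_cast hs.card_pos.ne'
  have h1r : τ 1 = ((τ 1).re : ℂ) := Complex.ext rfl (by simp [hτ.im_one])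
  have e : τ (D.hermSum ι a b s * D.hermSum ι a b s)
      = ((((τ 1).re + η * T - (s.card - 1) * T) / (2 * s.card) : ℝ) : ℂ) := by
    simp only [hermSum, smul_mul_assoc, mul_smul_comm, add_mul, mul_add, map_add, map_smul,
      smul_eq_mul, h1, h2, h3, h4]
    push_cast
    rw [← h1r]
    have e1 : ∀ x : ℂ, ι * (ι * x) = η * x := fun x => by rw [← hη]; ring
    have e2 : ∀ x : ℂ, starRingEnd ℂ ι * (starRingEnd ℂ ι * x) = η * x := fun x => by
      rw [← hcη]; ring
    have e3 : ∀ x : ℂ, starRingEnd ℂ ι * (ι * x) = x := fun x => by rw [← mul_assoc, hn, one_mul]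
    have e4 : ∀ x : ℂ, ι * (starRingEnd ℂ ι * x) = x := fun x => by rw [← mul_assoc, hn', one_mul]
    simp only [mul_left_comm ι (2 * (s.card : ℂ))⁻¹,
      mul_left_comm (starRingEnd ℂ ι) (2 * (s.card : ℂ))⁻¹, e1, e2, e3, e4]
    field_simp
    ring
  rw [e, Complex.ofReal_re]

end hermSum

end UnitarySpinRep

namespace UnitarySpinRep

variable {G α m : Type*} [Group G] [DecidableEq α] [Fintype m] [DecidableEq m]
  (D : UnitarySpinRep G α m)

/-- Every positive functional which is tracial for `c`, `l` is bounded by `A * τ 1` at the lifts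
of `σ`. -/
def TraceBound (c l : Finset α) (σ : Perm α) (A : ℝ) : Prop :=
  ∀ τ, PosFunctional τ → D.Tracial τ c l → ∀ y, D.π y = σ → ‖τ (D.R y)‖ ≤ A * (τ 1).re

variable {D}

lemma traceBound_one (c l : Finset α) (σ : Perm α) : D.TraceBound c l σ 1 := by
  intro τ hτ _ y _
  exact hτ.norm_le one_pos (by simp [D.conjTranspose_R, R_inv_mul])

lemma TraceBound.mono {c l c' l' : Finset α} {σ : Perm α} {A : ℝ} (h : D.TraceBound c' l' σ A)
    (hw : ∀ w, Admissible c' l' w → Admissible c l w) : D.TraceBound c l σ A :=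
  fun τ hτ ht => h τ hτ fun w h => ht w (hw _ h)

lemma Tracial.compress {τ : Matrix m m ℂ →ₗ[ℂ] ℂ} {c l c' l' : Finset α} (ht : D.Tracial τ c l)
    (hw : ∀ w, Admissible c' l' w → Admissible c l w) {X : Matrix m m ℂ}
    (hX : ∀ w, Admissible c' l' (D.π w) → D.R w * X = X * D.R w) :
    D.Tracial (PosFunctional.compress τ X) c' l' := by
  intro w h A
  rw [PosFunctional.compress_apply, PosFunctional.compress_apply, ← ht w (hw _ h) (X * (A * X))]
  have h2 : D.R w⁻¹ * X = X * D.R w⁻¹ := by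
    have := congrArg (fun B => D.R w⁻¹ * B * D.R w⁻¹) (hX w h)
    simp only [mul_assoc, R_mul_inv, mul_one, R_inv_mul_cancel_left] at this
    exact this.symm
  congr 1
  calc X * (D.R w * A * D.R w⁻¹ * X) = (X * D.R w) * A * (D.R w⁻¹ * X) := by
        simp only [mul_assoc]
    _ = _ := by rw [← hX w h, h2]; simp only [mul_assoc]

lemma admissible_of_insert {c s : Finset α} {a b : α} {w : Perm α}
    (hw : Admissible (insert a (insert b c)) s w) : Admissible c (insert a (insert b s)) w := by
  refine ⟨fun x hx => hw.1 x (by simp [hx]), fun x hx => ?_⟩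
  have ha := hw.1 a (by simp)
  have hb := hw.1 b (by simp)
  simp only [Finset.mem_insert] at hx ⊢
  rcases hx with rfl | rfl | hx
  · simp [ha]
  · simp [hb]
  · exact Or.inr (Or.inr (hw.2 x hx))

/-- A bound for a cycle through `p` gives one for the cycle extended by two points `a`, `b`. -/
lemma TraceBound.cyc_mul [Nonempty m] {c s : Finset α} {a b p : α} {σ : Perm α} {A β η : ℝ} {ι : ℂ}
    (h : D.TraceBound (insert a (insert b c)) s σ A) (hab : a ≠ b) (ha : a ∉ s) (hb : b ∉ s)
    (hp : p ∈ s) (hd : Disjoint c (insert a (insert b s)))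
    (hσ : Admissible (insert a (insert b c)) s σ) (htrans : ∀ q ∈ s, ∃ k : ℕ, (σ ^ k) p = q)
    (hη : ι ^ 2 = η) (hn : starRingEnd ℂ ι * ι = 1)
    (hsign : ∀ x y, D.π x = swap a b → D.π y = σ → D.R x * D.R y * D.R x⁻¹ = (η : ℂ) • D.R y)
    (hβ : 0 < β) (hA : 0 ≤ A)
    (hbound : ∀ t T : ℝ, -t / 2 ≤ T → T ≤ t →
      (t + η * T - (s.card - 1) * T) / (2 * s.card) ≤ β ^ 2 * t) :
    D.TraceBound c (insert a (insert b s)) (cyc a b p * σ) (A * β) := by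
  intro τ hτ ht x hx
  have hap : a ≠ p := by grind
  have hbp : b ≠ p := by grind
  have hal : a ∈ insert a (insert b s) := by simp
  have hbl : b ∈ insert a (insert b s) := by simp
  have hsl : s ⊆ insert a (insert b s) := by intro; simp +contextual
  obtain ⟨z, hz, -, hM⟩ := D.exists_M hab hap hbp
  obtain ⟨y, rfl⟩ : ∃ y, x = z * y := ⟨z⁻¹ * x, by simp⟩
  have hy : D.π y = σ := by simpa [hz] using hx
  obtain ⟨v, hv⟩ := D.surj (swap a b)
  obtain ⟨T, hT, hT1, hT2⟩ := ht.exists_map_M_eq hab hd hal hbl hτ hap hbp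
  have hTq : ∀ q ∈ s, τ (D.M a b q) = T := fun q hq => by
    rw [← hT]
    exact ht.map_M_third hd hab hap hbp (by grind) (by grind) (hsl hp) (hsl hq)
  have hσa : σ a = a := hσ.1 a (by simp)
  have hσb : σ b = b := hσ.1 b (by simp)
  have hcomm : ∀ w, Admissible (insert a (insert b c)) s (D.π w) →
      D.R w * D.hermSum ι a b s = D.hermSum ι a b s * D.R w := fun w hw =>
    hermSum_comm hab ha hb (hw.1 a (by simp)) (hw.1 b (by simp)) hw.2
  have hq : ∀ q ∈ s, τ (D.M a b q * D.R y) = τ (D.R (z * y)) := by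
    intro q hq
    obtain ⟨k, rfl⟩ := htrans q hq
    have h1 := ht (y ^ k) (by rw [map_pow, hy]; exact (admissible_of_insert hσ).pow k)
      (D.R (z * y))
    rw [← h1]
    have hk := hσ.pow k
    have h2 := D.M_conj hab hap hbp (y ^ k)
    rw [show D.π (y ^ k) = σ ^ k by rw [map_pow, hy], hk.1 a (by simp), hk.1 b (by simp)] at h2
    rw [← h2, hM, ← map_mul, ← map_mul, ← map_mul, ← map_mul, ← map_mul]
    congr 2
    group
  have hZ : τ (D.cycSum a b s * D.R y) = s.card * τ (D.R (z * y)) := by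
    rw [cycSum, Finset.sum_mul, map_sum, Finset.sum_congr rfl hq, Finset.sum_const, nsmul_eq_mul]
  have hZ' : τ ((D.cycSum a b s)ᴴ * D.R y) = η * (s.card * τ (D.R (z * y))) := by
    have h1 := ht v (by rw [hv]; exact Admissible.swap hd hal hbl) (D.cycSum a b s * D.R y)
    have h2 : D.R v * (D.cycSum a b s * D.R y) * D.R v⁻¹
        = (η : ℂ) • ((D.cycSum a b s)ᴴ * D.R y) := by
      rw [cycSum_conjTranspose hab ha hb, ← cycSum_conj_swap hab ha hb hv, ← mul_smul_comm,
        ← hsign v y hv hy]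
      simp only [mul_assoc, R_inv_mul_cancel_left]
    have hηη : (η : ℂ) * η = 1 := by
      rw [← hη]
      nth_rewrite 1 [hη]
      rw [← Complex.conj_ofReal, ← hη, map_pow, ← mul_pow, hn, one_pow]
    rw [h2, map_smul, hZ, smul_eq_mul] at h1
    rw [← h1, ← mul_assoc, hηη, one_mul]
  have hcard : (s.card : ℂ) ≠ 0 := by exact_mod_cast Finset.card_ne_zero_of_mem hp
  have hY : τ (D.R y * (1 * D.hermSum ι a b s)) = ι * τ (D.R (z * y)) := by
    rw [one_mul, hcomm y (by rw [hy]; exact hσ), hermSum, smul_mul_assoc, add_mul, smul_mul_assoc,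
      smul_mul_assoc, map_smul, map_add, map_smul, map_smul, hZ, hZ', ← hη]
    simp only [smul_eq_mul]
    have : starRingEnd ℂ ι * (ι ^ 2 * (s.card * τ (D.R (z * y))))
        = ι * (s.card * τ (D.R (z * y))) := by
      rw [pow_two, mul_assoc ι ι, ← mul_assoc _ ι, hn, one_mul]
    rw [this]
    field_simp
    ring
  have hι : ‖ι‖ = 1 := by
    have : ((‖ι‖ ^ 2 : ℝ) : ℂ) = 1 := by
      rw [← hn, mul_comm, Complex.mul_conj']; push_cast; rfl
    have h2 : ‖ι‖ ^ 2 = 1 := by exact_mod_cast this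
    nlinarith [norm_nonneg ι]
  have key := PosFunctional.norm_le_of_compress (τ := τ) (h := D.R y) (A := 1)
    (Y := D.hermSum ι a b s) (by simp) (by simp) (hcomm y (by rw [hy]; exact hσ)) (a := A) hβ
    (fun u v => by
      refine h _ (hτ.compress_pos ?_) (ht.compress (fun w => admissible_of_insert) ?_) y hy
      · simp [conjTranspose_add, conjTranspose_smul, hermSum_conjTranspose]
      · intro w hw
        simp only [mul_add, add_mul, mul_smul_comm, smul_mul_assoc, hcomm w hw, mul_one, one_mul])
  rw [hY, norm_mul, hι, one_mul, mul_one,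
    ht.map_hermSum_sq hab ha hb ⟨p, hp⟩ hd hal hbl hsl hτ hη hn hTq] at key
  refine key.trans ?_
  have h3 := hbound _ _ hT1 hT2
  have h4 : ((τ 1).re + η * T - (s.card - 1) * T) / (2 * s.card) / β ≤ β * (τ 1).re := by
    rw [div_le_iff₀ hβ]
    linarith
  have h5 : A / 2 * (β * (τ 1).re + ((τ 1).re + η * T - (s.card - 1) * T) / (2 * s.card) / β)
      ≤ A / 2 * (β * (τ 1).re + β * (τ 1).re) := by gcongr
  linarith

lemma M_conj_eq [Nonempty m] {a b c a' b' c' : α} (hab : a ≠ b) (hac : a ≠ c) (hbc : b ≠ c)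
    {w : G} (ha : D.π w a = a') (hb : D.π w b = b') (hc : D.π w c = c') :
    D.R w * D.M a b c = D.M a' b' c' * D.R w := by
  subst ha hb hc
  rw [← D.M_conj hab hac hbc]
  simp only [mul_assoc, R_inv_mul, mul_one]

end UnitarySpinRep

namespace UnitarySpinRep

variable {G α m : Type*} [Group G] [DecidableEq α] [Fintype m] [DecidableEq m]
  {D : UnitarySpinRep G α m}

lemma cyc_apply_left {a b c : α} (hab : a ≠ b) (hac : a ≠ c) : cyc a b c a = b := by
  rw [cyc, Perm.mul_apply, swap_apply_of_ne_of_ne hab hac, swap_apply_left]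

lemma cyc_apply_middle {a b c : α} (hac : a ≠ c) (hbc : b ≠ c) : cyc a b c b = c := by
  rw [cyc, Perm.mul_apply, swap_apply_left, swap_apply_of_ne_of_ne hac.symm hbc.symm]

lemma cyc_apply_right {a b c : α} : cyc a b c c = a := by
  rw [cyc, Perm.mul_apply, swap_apply_right, swap_apply_right]

lemma cyc_apply_of_ne {a b c x : α} (ha : x ≠ a) (hb : x ≠ b) (hc : x ≠ c) : cyc a b c x = x := by
  rw [cyc, Perm.mul_apply, swap_apply_of_ne_of_ne hb hc, swap_apply_of_ne_of_ne ha hb]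

set_option maxHeartbeats 1000000 in
/-- The bound for a five-cycle. -/
lemma TraceBound.cyc_mul_cyc_mul [Nonempty m] {c : Finset α} {a b p q r : α} {σ : Perm α}
    {A : ℝ} {d : ℕ} (hnd : [a, b, p, q, r].Nodup)
    (h : D.TraceBound (insert a (insert b (insert p (insert q (insert r c))))) ∅ σ A)
    (hd : Disjoint c {a, b, p, q, r})
    (hσ : ∀ x ∈ insert a (insert b (insert p (insert q (insert r c)))), σ x = x)
    (hodd : Odd d) (hσd : σ ^ d = 1) (hA : 0 ≤ A) :
    D.TraceBound c {a, b, p, q, r} (cyc a b p * cyc p q r * σ) ((29 / 100) * A) := by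
  intro τ hτ ht x hx
  simp only [List.nodup_cons, List.mem_cons, not_or, List.not_mem_nil, not_false_eq_true,
    and_true] at hnd
  obtain ⟨⟨hab, hap, haq, har⟩, ⟨hbp, hbq, hbr⟩, ⟨hpq, hpr⟩, hqr, -⟩ := hnd
  rw [← ne_eq] at hab hap haq har hbp hbq hbr hpq hpr hqr
  have hal : a ∈ ({a, b, p, q, r} : Finset α) := by simp
  have hbl : b ∈ ({a, b, p, q, r} : Finset α) := by simp
  have hpl : p ∈ ({a, b, p, q, r} : Finset α) := by simp
  have hql : q ∈ ({a, b, p, q, r} : Finset α) := by simp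
  have hrl : r ∈ ({a, b, p, q, r} : Finset α) := by simp
  have hsl : {p, q, r} ⊆ ({a, b, p, q, r} : Finset α) := by intro; simp +contextual
  obtain ⟨z₁, hz₁, -, hM₁⟩ := D.exists_M hab hap hbp
  obtain ⟨z₂, hz₂, -, hM₂⟩ := D.exists_M hpq hpr hqr
  obtain ⟨y, rfl⟩ : ∃ y, x = z₁ * (z₂ * y) := ⟨(z₁ * z₂)⁻¹ * x, by group⟩
  have hy : D.π y = σ := by simpa [hz₁, hz₂, mul_assoc] using hx
  obtain ⟨v, hv⟩ := D.surj (swap a b)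
  obtain ⟨w, hw⟩ := D.surj (swap p q)
  obtain ⟨T, hT, hT1, hT2⟩ := ht.exists_map_M_eq hab hd hal hbl hτ hap hbp
  have hTq : ∀ u ∈ ({p, q, r} : Finset α), τ (D.M a b u) = T := fun u hu => by
    have hau : a ≠ u := by rintro rfl; simp_all
    have hbu : b ≠ u := by rintro rfl; simp_all
    rw [← hT]
    exact ht.map_M_third hd hab hap hbp hau hbu hpl (hsl hu)
  have hfix : ∀ x ∈ ({a, b, p, q, r} : Finset α), σ x = x := fun x hx => hσ x (by simp at hx ⊢; tauto)
  have hσa := hfix a hal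
  have hσb := hfix b hbl
  have hσp := hfix p hpl
  have hσq := hfix q hql
  have hσr := hfix r hrl
  have has : a ∉ ({p, q, r} : Finset α) := by simp [hap, haq, har]
  have hbs : b ∉ ({p, q, r} : Finset α) := by simp [hbp, hbq, hbr]
  set N := D.M p q r with hN
  set s : Finset α := {p, q, r} with hs
  have hc3 : s.card = 3 := by
    rw [hs, Finset.card_eq_three]; exact ⟨p, q, r, hpq, hpr, hqr, rfl⟩
  -- commutation relations
  have hvy : D.R v * D.R y = D.R y * D.R v :=
    R_conj_of_odd_pow D hodd (by rw [hy]; exact hσd) (by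
      rw [hv, hy, mul_swap_eq_swap_mul, hσa, hσb])
  have hwy : D.R w * D.R y = D.R y * D.R w :=
    R_conj_of_odd_pow D hodd (by rw [hy]; exact hσd) (by
      rw [hw, hy, mul_swap_eq_swap_mul, hσp, hσq])
  have hvN : D.R v * N = N * D.R v := M_conj_eq hpq hpr hqr
    (by rw [hv]; exact swap_apply_of_ne_of_ne hap.symm hbp.symm)
    (by rw [hv]; exact swap_apply_of_ne_of_ne haq.symm hbq.symm)
    (by rw [hv]; exact swap_apply_of_ne_of_ne har.symm hbr.symm)
  have hwN : D.R w * N = Nᴴ * D.R w := by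
    rw [hN, D.M_conjTranspose hpq hpr hqr]
    exact M_conj_eq hpq hpr hqr (by rw [hw, swap_apply_left]) (by rw [hw, swap_apply_right])
      (by rw [hw, swap_apply_of_ne_of_ne hpr.symm hqr.symm])
  set Y := D.hermSum 1 a b s with hY
  have hwY : D.R w * Y = Y * D.R w := hermSum_comm hab has hbs
    (by rw [hw, swap_apply_of_ne_of_ne hap haq]) (by rw [hw, swap_apply_of_ne_of_ne hbp hbq])
    (by rw [hw]; intro x hx; rw [swap_apply_def]; split_ifs <;> simp_all)
  have hz₂Y : N * Y = Y * N := by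
    rw [hM₂]
    exact hermSum_comm hab has hbs (by rw [hz₂, cyc_apply_of_ne hap haq har])
      (by rw [hz₂, cyc_apply_of_ne hbp hbq hbr])
      (by
        rw [hz₂]
        intro x hx
        simp only [hs, Finset.mem_insert, Finset.mem_singleton] at hx ⊢
        rcases hx with rfl | rfl | rfl
        · simp [cyc_apply_left hpq hpr]
        · simp [cyc_apply_middle hpr hqr]
        · simp [cyc_apply_right])
  have hY' : Yᴴ = Y := hermSum_conjTranspose
  have hNY' : Nᴴ * Y = Y * Nᴴ := by
    have := congrArg conjTranspose hz₂Y
    simp only [conjTranspose_mul, hY'] at this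
    exact this.symm
  have fixY : ∀ u, (∀ x ∈ ({a, b, p, q, r} : Finset α), D.π u x = x) →
      D.R u * Y = Y * D.R u := fun u hu =>
    hermSum_comm hab has hbs (hu a hal) (hu b hbl) (fun x hx => by rw [hu x (hsl hx)]; exact hx)
  have fixN : ∀ u, (∀ x ∈ ({a, b, p, q, r} : Finset α), D.π u x = x) →
      D.R u * N = N * D.R u := fun u hu => M_conj_eq hpq hpr hqr (hu p hpl) (hu q hql) (hu r hrl)
  have fixN' : ∀ u, (∀ x ∈ ({a, b, p, q, r} : Finset α), D.π u x = x) →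
      D.R u * Nᴴ = Nᴴ * D.R u := fun u hu => by
    rw [hN, D.M_conjTranspose hpq hpr hqr]
    exact M_conj_eq hpq.symm hqr hpr (hu q hql) (hu p hpl) (hu r hrl)
  have hyN := fixN y (by rw [hy]; exact hfix)
  -- averaging
  have hx0 : D.R (z₁ * (z₂ * y)) = D.M a b p * N * D.R y := by
    rw [hM₁, hM₂, map_mul, map_mul, mul_assoc]
  have hNinv := D.M_mul_conjTranspose hpq hpr hqr
  have hNinv' := D.M_conjTranspose_mul hpq hpr hqr
  rw [← hN] at hNinv hNinv'
  have step : ∀ u u', u ∈ s → cyc p q r u = u' →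
      τ (D.M a b u' * N * D.R y) = τ (D.M a b u * N * D.R y) := by
    intro u u' hu huu
    rw [← ht z₂ (by rw [hz₂]; exact Admissible.cyc hd hpl hql hrl) (D.M a b u * N * D.R y),
      ← D.conjTranspose_R, ← hM₂]
    have e := M_conj_eq (D := D) (w := z₂) (c := u) (c' := u') hab (by grind) (by grind)
      (by rw [hz₂, cyc_apply_of_ne hap haq har]) (by rw [hz₂, cyc_apply_of_ne hbp hbq hbr])
      (by rw [hz₂, huu])
    rw [← hM₂] at e
    congr 1
    calc D.M a b u' * N * D.R y = D.M a b u' * N * (N * D.R y * Nᴴ) := by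
          rw [← hyN, mul_assoc (D.R y), hNinv, mul_one]
      _ = D.M a b u' * N * N * D.R y * Nᴴ := by simp only [mul_assoc]
      _ = _ := by rw [← e]; simp only [mul_assoc]
  have hq1 := step p q (by simp [hs]) (cyc_apply_left hpq hpr)
  have hr1 := step q r (by simp [hs]) (cyc_apply_middle hpr hqr)
  have hZ : τ (D.cycSum a b s * N * D.R y) = 3 * τ (D.R (z₁ * (z₂ * y))) := by
    rw [cycSum, hs, Finset.sum_insert (by simp [hpq, hpr]), Finset.sum_pair hqr, add_mul, add_mul,
      add_mul, add_mul, map_add, map_add, hr1, hq1, hx0]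
    ring
  have hZ' : τ ((D.cycSum a b s)ᴴ * N * D.R y) = 3 * τ (D.R (z₁ * (z₂ * y))) := by
    rw [← hZ, ← ht v (by rw [hv]; exact Admissible.swap hd hal hbl) (D.cycSum a b s * N * D.R y),
      cycSum_conjTranspose hab has hbs, ← cycSum_conj_swap hab has hbs hv]
    congr 1
    calc D.R v * D.cycSum a b s * D.R v⁻¹ * N * D.R y
        = D.R v * D.cycSum a b s * (D.R v⁻¹ * (N * D.R y * D.R v) * D.R v⁻¹) := by
          simp only [mul_assoc, R_mul_inv, mul_one]
      _ = _ := by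
          rw [mul_assoc N, ← hvy, ← mul_assoc N, ← hvN]
          simp only [mul_assoc, R_inv_mul_cancel_left]
  have hYN : τ (Y * N * D.R y) = τ (D.R (z₁ * (z₂ * y))) := by
    rw [hY, hermSum, hc3, map_one, one_smul, one_smul, smul_mul_assoc, smul_mul_assoc, add_mul,
      add_mul, map_smul, map_add, hZ, hZ']
    simp only [smul_eq_mul]
    push_cast
    ring
  have hYN' : τ (Y * Nᴴ * D.R y) = τ (D.R (z₁ * (z₂ * y))) := by
    rw [← hYN, ← ht w (by rw [hw]; exact Admissible.swap hd hpl hql) (Y * N * D.R y)]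
    congr 1
    calc Y * Nᴴ * D.R y = Y * Nᴴ * D.R y * (D.R w * D.R w⁻¹) := by rw [R_mul_inv, mul_one]
      _ = Y * (Nᴴ * (D.R y * D.R w)) * D.R w⁻¹ := by simp only [mul_assoc]
      _ = Y * D.R w * N * D.R y * D.R w⁻¹ := by
          rw [← hwy, ← mul_assoc Nᴴ, ← hwN]; simp only [mul_assoc]
      _ = _ := by rw [← hwY]; simp only [mul_assoc]
  set B := (2⁻¹ : ℂ) • (N + Nᴴ) with hB
  have hBY : B * Y = Y * B := by
    simp only [hB, smul_mul_assoc, mul_smul_comm, add_mul, mul_add, hz₂Y, hNY']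
  have fixB : ∀ u, (∀ x ∈ ({a, b, p, q, r} : Finset α), D.π u x = x) →
      D.R u * B = B * D.R u := fun u hu => by
    simp only [hB, smul_mul_assoc, mul_smul_comm, add_mul, mul_add, fixN u hu, fixN' u hu]
  have hBB : (τ (B * B)).re = ((τ 1).re + T) / 2 := by
    have hNsq := D.M_sq hpq hpr hqr
    rw [← hN] at hNsq
    have hNsq' : Nᴴ * Nᴴ = N := by
      rw [← conjTranspose_mul, hNsq, conjTranspose_conjTranspose]
    have hTN : τ N = T := by
      rw [hN, ← hT]
      have := ht.map_M hab hap hbp ((((Admissible.cyc hd hal hbl hpl).mul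
        (Admissible.cyc hd hpl hql hrl))).pow 2)
      simp only [pow_two, Perm.mul_apply] at this
      rwa [cyc_apply_of_ne hap haq har, cyc_apply_left hab hap,
        cyc_apply_of_ne hbp hbq hbr, cyc_apply_middle hap hbp, cyc_apply_left hpq hpr,
        cyc_apply_of_ne haq.symm hbq.symm hpq.symm, cyc_apply_middle hpr hqr,
        cyc_apply_of_ne har.symm hbr.symm hpr.symm] at this
    simp only [hB, smul_mul_assoc, mul_smul_comm, add_mul, mul_add, hNsq, hNsq', hNinv, hNinv',
      map_smul, map_add, hτ.map_conjTranspose, hTN, Complex.conj_ofReal, smul_eq_mul]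
    simp
    ring
  have hYY := ht.map_hermSum_sq (ι := 1) (η := 1) hab has hbs ⟨p, by simp [hs]⟩ hd hal hbl hsl hτ
    (by simp) (by simp) hTq
  have hadm : ∀ u, Admissible (insert a (insert b (insert p (insert q (insert r c))))) ∅ u →
      ∀ x ∈ ({a, b, p, q, r} : Finset α), u x = x := by
    intro u hu x hx
    exact hu.1 x (by simp at hx ⊢; tauto)
  have key := PosFunctional.norm_le_of_compress (τ := τ) (h := D.R y) (A := B) (Y := Y)
    hBY (fixB y (by rw [hy]; exact hfix)) (fixY y (by rw [hy]; exact hfix)) (a := A)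
    (s := (29 / 50)) (by norm_num)
    (fun t₁ t₂ => by
      refine h _ (hτ.compress_pos ?_) (ht.compress (fun w hw => ?_) ?_) y hy
      · simp [conjTranspose_add, conjTranspose_smul, hY', hB, add_comm]
      · exact ⟨fun x hx => hw.1 x (by simp [hx]), fun x hx => by rw [hadm w hw x hx]; exact hx⟩
      · intro w hw
        simp only [mul_add, add_mul, mul_smul_comm, smul_mul_assoc, fixB w (hadm _ hw),
          fixY w (hadm _ hw)])
  have hfin : τ (D.R y * (B * Y)) = τ (D.R (z₁ * (z₂ * y))) := by
    rw [hBY, ← mul_assoc, fixY y (by rw [hy]; exact hfix), mul_assoc,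
      fixB y (by rw [hy]; exact hfix), ← mul_assoc, hB, mul_smul_comm, smul_mul_assoc, mul_add,
      add_mul, map_smul, map_add, hYN, hYN', smul_eq_mul]
    ring
  rw [hfin, hBB, hYY, hc3] at key
  refine key.trans ?_
  have : (29 / 50) * (((τ 1).re + T) / 2) + ((τ 1).re + 1 * T - (3 - 1) * T) / (2 * 3) / (29 / 50)
      ≤ 2 * (29 / 100) * (τ 1).re := by linarith
  calc _ ≤ A / 2 * (2 * (29 / 100) * (τ 1).re) := by
        push_cast
        gcongr
    _ = _ := by ring

end UnitarySpinRep

namespace UnitarySpinRep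

section perm

variable {α : Type*} [DecidableEq α]

lemma formPerm_cons_cons_cons (a b p : α) (l : List α) :
    (a :: b :: p :: l).formPerm = cyc a b p * (p :: l).formPerm := by
  rw [List.formPerm_cons_cons, List.formPerm_cons_cons, cyc, mul_assoc]

lemma formPerm_commute {l : List α} {σ : Perm α} (hσ : ∀ x ∈ l, σ x = x) :
    Commute l.formPerm σ := by
  apply Perm.Disjoint.commute
  intro x
  by_cases hx : x ∈ l
  · exact Or.inr (hσ x hx)
  · exact Or.inl (List.formPerm_apply_of_notMem hx)

lemma formPerm_mul_pow_eq_one {l : List α} {σ : Perm α} {k : ℕ} (hl : l.Nodup)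
    (hσ : ∀ x ∈ l, σ x = x) (hk : σ ^ k = 1) : (l.formPerm * σ) ^ (l.length * k) = 1 := by
  have h : l.formPerm ^ l.length = 1 := List.formPerm_pow_length_eq_one_of_nodup l hl
  rw [(formPerm_commute hσ).mul_pow, pow_mul, h, mul_comm l.length, pow_mul, hk, one_pow, one_pow,
    one_mul]

lemma exists_formPerm_mul_pow_apply {p q : α} {l : List α} {σ : Perm α} (hl : (p :: l).Nodup)
    (hσ : ∀ x ∈ p :: l, σ x = x) (hq : q ∈ p :: l) :
    ∃ k : ℕ, (((p :: l).formPerm * σ) ^ k) p = q := by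
  obtain ⟨k, hk, rfl⟩ := List.getElem_of_mem hq
  refine ⟨k, ?_⟩
  rw [(formPerm_commute hσ).mul_pow, Perm.mul_apply,
    Perm.pow_apply_eq_self_of_apply_eq_self (hσ p (by simp)),
    List.formPerm_pow_apply_head p l hl, ]
  simp only [Nat.mod_eq_of_lt hk]

lemma admissible_formPerm_mul {c : Finset α} {l : List α} {σ : Perm α}
    (hd : ∀ x ∈ c, x ∉ l) (hσc : ∀ x ∈ c, σ x = x) (hσ : ∀ x ∈ l, σ x = x) :
    Admissible c l.toFinset (l.formPerm * σ) := by
  constructor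
  · intro x hx
    rw [Perm.mul_apply, hσc x hx, List.formPerm_apply_of_notMem (hd x hx)]
  · intro x hx
    simp only [List.mem_toFinset] at hx ⊢
    rw [Perm.mul_apply, hσ x hx, List.formPerm_mem_iff_mem]
    exact hx

lemma notMem_of_mem_insert {a b : α} {c : Finset α} {l : List α} (hl : (a :: b :: l).Nodup)
    (hd : Disjoint c (a :: b :: l).toFinset) : ∀ x ∈ insert a (insert b c), x ∉ l := by
  intro x hx
  rw [List.nodup_cons, List.nodup_cons] at hl
  simp only [Finset.mem_insert] at hx
  rcases hx with rfl | rfl | hx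
  · exact fun h => hl.1 (List.mem_cons_of_mem _ h)
  · exact hl.2.1
  · have := Finset.disjoint_left.1 hd hx
    simp at this ⊢
    tauto

end perm

variable {G α m : Type*} [Group G] [DecidableEq α] [Fintype m] [DecidableEq m]
  {D : UnitarySpinRep G α m}

/-- The bound for a cycle of odd length at least five. -/
lemma TraceBound.formPerm_mul_of_odd [Nonempty m] {σ : Perm α} {A : ℝ} {k : ℕ} (hA : 0 ≤ A)
    (hk : Odd k) (hσk : σ ^ k = 1) (i : ℕ) (l : List α) (c : Finset α) (hlen : l.length = 2 * i + 5)
    (hl : l.Nodup) (hd : Disjoint c l.toFinset) (hσc : ∀ x ∈ c, σ x = x)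
    (hσl : ∀ x ∈ l, σ x = x) (h : D.TraceBound (l.toFinset ∪ c) ∅ σ A) :
    D.TraceBound c l.toFinset (l.formPerm * σ) (29 / 100 * (1 / 2) ^ i * A) := by
  induction i generalizing l c with
  | zero =>
    match l, hlen with
    | [a, b, p, q, r], _ =>
      have hc : insert a (insert b (insert p (insert q (insert r c)))) =
          [a, b, p, q, r].toFinset ∪ c := by ext; simp
      have hs : ([a, b, p, q, r].toFinset : Finset α) = {a, b, p, q, r} := by ext; simp
      have e : [a, b, p, q, r].formPerm = cyc a b p * cyc p q r := by
        rw [formPerm_cons_cons_cons, formPerm_cons_cons_cons, List.formPerm_singleton, mul_one]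
      rw [hs, e, pow_zero, mul_one]
      refine TraceBound.cyc_mul_cyc_mul hl (by rw [hc]; exact h) (hs ▸ hd) ?_ hk hσk hA
      rw [hc]
      intro x hx
      simp only [Finset.mem_union, List.mem_toFinset] at hx
      exact hx.elim (hσl x) (hσc x)
  | succ i ih =>
    match l, hlen with
    | a :: b :: p :: l', hlen =>
      have hlen' : (p :: l').length = 2 * i + 5 := by simp only [List.length_cons] at hlen ⊢; omega
      have hl' := hl
      rw [List.nodup_cons, List.nodup_cons] at hl'
      obtain ⟨ha, hb, hpl⟩ := hl'
      have hab : a ≠ b := by rintro rfl; simp at ha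
      have ha' : a ∉ p :: l' := fun h => ha (List.mem_cons_of_mem _ h)
      have hσp : ∀ x ∈ p :: l', σ x = x := fun x hx => hσl x (by simp at hx ⊢; tauto)
      have hdc : ∀ x ∈ insert a (insert b c), x ∉ p :: l' := notMem_of_mem_insert hl hd
      have hσc' : ∀ x ∈ insert a (insert b c), σ x = x := by
        intro x hx
        simp only [Finset.mem_insert] at hx
        rcases hx with rfl | rfl | hx
        · exact hσl _ (by simp)
        · exact hσl _ (by simp)
        · exact hσc x hx
      have hIH := ih (p :: l') (insert a (insert b c)) hlen' hpl
        (Finset.disjoint_left.2 fun x hx hx' => hdc x hx (List.mem_toFinset.1 hx')) hσc' hσp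
        (by convert h using 1; ext; simp)
      have hcard : ((p :: l').toFinset.card : ℝ) = 2 * i + 5 := by
        rw [List.toFinset_card_of_nodup hpl, hlen']; push_cast; ring
      have hs : (a :: b :: p :: l').toFinset = insert a (insert b (p :: l').toFinset) := by simp
      rw [formPerm_cons_cons_cons, mul_assoc, hs]
      have key := TraceBound.cyc_mul (ι := 1) (η := 1) (β := 1 / 2) hIH hab
        (by rwa [List.mem_toFinset]) (by rwa [List.mem_toFinset]) (p := p) (by simp)
        (by rwa [← hs]) (admissible_formPerm_mul hdc hσc' hσp)
        (fun q hq => exists_formPerm_mul_pow_apply hpl hσp (List.mem_toFinset.1 hq))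
        (by simp) (by simp) ?_ (by norm_num) (by positivity) ?_
      · convert key using 1; ring
      · intro x y hx hy
        rw [R_conj_of_odd_pow D (d := (p :: l').length * k) _ _ _, mul_assoc, R_mul_inv]
        · simp
        · exact Odd.mul ⟨i + 2, by rw [hlen']; ring⟩ hk
        · rw [hy]; exact formPerm_mul_pow_eq_one hpl hσp hσk
        · rw [hx, hy, mul_swap_eq_swap_mul, Perm.mul_apply, Perm.mul_apply, hσc' a (by simp),
            hσc' b (by simp), List.formPerm_apply_of_notMem ha',
            List.formPerm_apply_of_notMem hb]
      · intro t T h1 h2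
        rw [hcard, div_le_iff₀ (by positivity)]
        nlinarith [(Nat.cast_nonneg i : (0 : ℝ) ≤ i)]

/-- The lifts of a cycle of even length anticommute with those of a disjoint transposition. -/
lemma R_mul_formPerm {a b : α} (hab : a ≠ b) (l : List α) (hl : l.Nodup) (ha : a ∉ l) (hb : b ∉ l)
    {x y : G} (hx : D.π x = swap a b) (hy : D.π y = l.formPerm) :
    D.R x * D.R y = (-1 : ℂ) ^ (l.length - 1) • (D.R y * D.R x) := by
  induction l generalizing y with
  | nil =>
    rcases D.fiber y 1 (by simpa using hy) with h | h <;> simp [h]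
  | cons p l ih =>
    match l, ih with
    | [], _ => rcases D.fiber y 1 (by simpa using hy) with h | h <;> simp [h]
    | q :: l, ih =>
      obtain ⟨u, hu⟩ := D.surj (swap p q)
      obtain ⟨v, rfl⟩ : ∃ v, y = u * v := ⟨u⁻¹ * y, by group⟩
      have hv : D.π v = (q :: l).formPerm := by
        rw [map_mul, hu, List.formPerm_cons_cons] at hy
        exact mul_left_cancel hy
      have := ih hl.of_cons (fun h => ha (List.mem_cons_of_mem _ h))
        (fun h => hb (List.mem_cons_of_mem _ h)) hv
      have h2 := D.swap_anticomm x u a b p q (by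
        simp only [List.nodup_cons, List.mem_cons, not_or] at ha hb hl ⊢
        simp
        tauto) hx hu
      simp only [List.length_cons, Nat.add_sub_cancel] at this ⊢
      rw [map_mul, ← mul_assoc, h2, neg_mul, mul_assoc, this, pow_succ]
      simp [mul_assoc]

/-- The bound for a cycle of even length. -/
lemma TraceBound.formPerm_of_even [Nonempty m] (i : ℕ) (l : List α) (c : Finset α)
    (hlen : l.length = 2 * i + 2) (hl : l.Nodup) (hd : Disjoint c l.toFinset) :
    D.TraceBound c l.toFinset l.formPerm (Real.sqrt ((i + 1) / 4 ^ i)) := by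
  induction i generalizing l c with
  | zero => simpa using traceBound_one c l.toFinset l.formPerm
  | succ i ih =>
    match l, hlen with
    | a :: b :: p :: l', hlen =>
      have hlen' : (p :: l').length = 2 * i + 2 := by simp only [List.length_cons] at hlen ⊢; omega
      have hl' := hl
      rw [List.nodup_cons, List.nodup_cons] at hl'
      obtain ⟨ha, hb, hpl⟩ := hl'
      have hab : a ≠ b := by rintro rfl; simp at ha
      have ha' : a ∉ p :: l' := fun h => ha (List.mem_cons_of_mem _ h)
      have hdc : ∀ x ∈ insert a (insert b c), x ∉ p :: l' := notMem_of_mem_insert hl hd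
      have hIH := ih (p :: l') (insert a (insert b c)) hlen' hpl
        (Finset.disjoint_left.2 fun x hx hx' => hdc x hx (List.mem_toFinset.1 hx'))
      have hcard : ((p :: l').toFinset.card : ℝ) = 2 * i + 2 := by
        rw [List.toFinset_card_of_nodup hpl, hlen']; push_cast; ring
      have hs : (a :: b :: p :: l').toFinset = insert a (insert b (p :: l').toFinset) := by simp
      rw [formPerm_cons_cons_cons, hs]
      have hi : (0 : ℝ) ≤ i := Nat.cast_nonneg i
      have hβ : (0 : ℝ) < (i + 2) / (4 * (i + 1)) := by positivity
      have key := TraceBound.cyc_mul (ι := Complex.I) (η := -1)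
        (β := Real.sqrt ((i + 2) / (4 * (i + 1)))) hIH hab
        (by rwa [List.mem_toFinset]) (by rwa [List.mem_toFinset]) (p := p) (by simp)
        (by rwa [← hs])
        (by simpa using admissible_formPerm_mul (σ := 1) hdc (by simp) (by simp))
        (fun q hq => by
          simpa using exists_formPerm_mul_pow_apply (σ := 1) hpl (by simp) (List.mem_toFinset.1 hq))
        (by simp) (by simp) ?_ (Real.sqrt_pos.2 hβ) (Real.sqrt_nonneg _) ?_
      · convert key using 1
        rw [← Real.sqrt_mul (by positivity)]
        congr 1
        push_cast
        field_simp
        ring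
      · intro x y hx hy
        rw [R_mul_formPerm hab (p :: l') hpl ha' hb hx hy, smul_mul_assoc, mul_assoc, R_mul_inv,
          hlen', Odd.neg_one_pow ⟨i, by omega⟩]
        simp
      · intro t T h1 h2
        rw [hcard, Real.sq_sqrt hβ.le, div_le_iff₀ (by positivity)]
        field_simp
        nlinarith

end UnitarySpinRep

namespace UnitarySpinRep

variable {G α m : Type*} [Group G] [DecidableEq α] [Fintype m] [DecidableEq m]
  {D : UnitarySpinRep G α m}

omit [DecidableEq m] in
lemma posFunctional_trace : PosFunctional (traceLinearMap m ℂ ℂ) := fun A =>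
  (posSemidef_conjTranspose_mul_self A).trace_nonneg

lemma tracial_trace (c l : Finset α) : D.Tracial (traceLinearMap m ℂ ℂ) c l := by
  intro w _ A
  simp only [traceLinearMap_apply]
  rw [trace_mul_comm, ← mul_assoc, R_inv_mul, one_mul]

/-- The traces at the lifts of a permutation which permutes the orbits of length `d` of `a` and `b`
cyclically vanish if `d` is even. -/
lemma trace_eq_zero_of_even {x : G} {a b : α} {d : ℕ} (hd : Even d) (hd0 : 0 < d)
    (hx : D.π x ^ d = 1)
    (hnd : ∀ i, 0 < i → i < d → [a, b, (D.π x ^ i) a, (D.π x ^ i) b].Nodup) :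
    trace (D.R x) = 0 := by
  obtain ⟨s, hs⟩ := D.surj (swap a b)
  have hW : ∀ i < d, D.R s * D.R ((s * x) ^ (i + 1) * (x ^ (i + 1))⁻¹) =
      (-1 : ℂ) ^ i • (D.R ((s * x) ^ (i + 1) * (x ^ (i + 1))⁻¹) * D.R s) := by
    intro i hi
    induction i with
    | zero => simp
    | succ i ih =>
      have e : (s * x) ^ (i + 1 + 1) * (x ^ (i + 1 + 1))⁻¹ =
          (s * x) ^ (i + 1) * (x ^ (i + 1))⁻¹ * (x ^ (i + 1) * s * (x ^ (i + 1))⁻¹) := by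
        rw [pow_succ (s * x), pow_succ x (i + 1)]; group
      have h := D.swap_anticomm s (x ^ (i + 1) * s * (x ^ (i + 1))⁻¹) a b _ _
        (hnd (i + 1) i.succ_pos hi) hs (by
          rw [map_mul, map_mul, map_inv, map_pow, hs, mul_swap_eq_swap_mul, mul_assoc,
            mul_inv_cancel, mul_one])
      rw [e, map_mul D.R, ← mul_assoc, ih (Nat.lt_of_succ_lt hi), smul_mul_assoc, mul_assoc, h,
        pow_succ (-1 : ℂ), map_mul D.R]
      simp only [mul_neg, mul_one, smul_neg, neg_smul, mul_assoc]
  have hU : D.R s * D.R ((s * x) ^ d) = -(D.R ((s * x) ^ d) * D.R s) := by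
    have h := hW (d - 1) (Nat.sub_lt hd0 one_pos)
    rw [show d - 1 + 1 = d from Nat.sub_add_cancel hd0,
      Odd.neg_one_pow (n := d - 1) (Nat.Even.sub_odd hd0 hd odd_one), map_mul] at h
    rcases D.R_of_map_eq_one (x := (x ^ d)⁻¹) (by simp [hx]) with e | e
    · simpa [e] using h
    · simpa [e, neg_eq_iff_eq_neg] using h
  have hXU : D.R x * D.R ((s * x) ^ d) = -(D.R ((s * x) ^ d) * D.R x) := by
    have e : x * (s * x) ^ d = s⁻¹ * ((s * x) ^ d * s) * x := by
      have h1 : x * (s * x) ^ d = (x * s) ^ d * x := by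
        rw [← SemiconjBy.eq (SemiconjBy.pow_right (show SemiconjBy x (s * x) (x * s) by
          simp [SemiconjBy, mul_assoc]) d)]
      have h2 : (s * x) ^ d * s = s * (x * s) ^ d :=
        (SemiconjBy.eq (SemiconjBy.pow_right (show SemiconjBy s (x * s) (s * x) by
          simp [SemiconjBy, mul_assoc]) d)).symm
      rw [h1, h2, inv_mul_cancel_left]
    rw [← map_mul, e, map_mul, map_mul, map_mul, ← neg_eq_iff_eq_neg.2 hU, mul_neg,
      R_inv_mul_cancel_left, neg_mul]
  have : trace (D.R x) = -trace (D.R x) := by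
    conv_lhs => rw [← mul_one (D.R x), ← D.R_mul_inv ((s * x) ^ d), ← mul_assoc, hXU, neg_mul,
      trace_neg, trace_mul_comm, R_inv_mul_cancel_left]
  exact self_eq_neg.1 this

/-- An averaging element `P` for the lift `x`, supported on `F`. -/
def IsAveraging (D : UnitarySpinRep G α m) (x : G) (F : Finset α) (P : Matrix m m ℂ) (k : ℕ) :
    Prop :=
  trace (D.R x * P) = trace (D.R x) ∧ Pᴴ * P = ((1 / 4 : ℂ) ^ k) • (1 : Matrix m m ℂ) ∧
    ∀ s c d, c ≠ d → c ∉ F → d ∉ F → D.π s = swap c d → D.R s * P = P * D.R s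

lemma isAveraging_one (x : G) : D.IsAveraging x ∅ 1 0 := by
  simp [IsAveraging]

lemma quaternion_sq {S₀ S₁ S₂ : Matrix m m ℂ} (q0 : S₀ * S₀ = -1) (q1 : S₁ * S₁ = -1)
    (q2 : S₂ * S₂ = -1) (c01 : S₀ * S₁ = -(S₁ * S₀)) (c02 : S₀ * S₂ = -(S₂ * S₀))
    (c12 : S₁ * S₂ = -(S₂ * S₁)) :
    (S₀ * S₁ + S₁ * S₂ + S₂ * S₀) * (S₀ * S₁ + S₁ * S₂ + S₂ * S₀) = -(3 : ℂ) • 1 := by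
  have sq : ∀ {A B : Matrix m m ℂ}, A * A = -1 → B * B = -1 → A * B = -(B * A) →
      A * B * (A * B) = -1 := by
    intro A B hA hB hAB
    nth_rw 2 [hAB]
    rw [mul_neg, mul_assoc, ← mul_assoc B, hB, neg_one_mul, mul_neg, neg_neg, hA]
  have anti : ∀ {A B C : Matrix m m ℂ}, B * B = -1 → B * C = -(C * B) → A * B = -(B * A) →
      A * C = -(C * A) → A * B * (B * C) + B * C * (A * B) = 0 := by
    intro A B C hB hBC hAB hAC
    rw [mul_assoc, ← mul_assoc B, hB, hAB, hBC, neg_mul_neg, mul_assoc, ← mul_assoc B, hB]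
    simp [hAC]
  have c10 : S₁ * S₀ = -(S₀ * S₁) := by rw [c01, neg_neg]
  have c20 : S₂ * S₀ = -(S₀ * S₂) := by rw [c02, neg_neg]
  have c21 : S₂ * S₁ = -(S₁ * S₂) := by rw [c12, neg_neg]
  have e1 := sq q0 q1 c01
  have e2 := sq q1 q2 c12
  have e3 := sq q2 q0 c20
  have e4 := anti q1 c12 c01 c02
  have e5 := anti q2 c20 c12 c10
  have e6 := anti q0 c01 c20 c21
  have : ∀ i j k : Matrix m m ℂ, (i + j + k) * (i + j + k) =
      i * i + j * j + k * k + (i * j + j * i) + (j * k + k * j) + (k * i + i * k) := by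
    intros; noncomm_ring
  rw [this, e1, e2, e3, e4, e5, e6]
  module

lemma trace_mul_quaternion {X P S₀ S₁ S₂ : Matrix m m ℂ} (q0 : S₀ * S₀ = -1) (q2 : S₂ * S₂ = -1)
    (c01 : S₀ * S₁ = -(S₁ * S₀)) (c02 : S₀ * S₂ = -(S₂ * S₀)) (k1 : X * S₁ = S₂ * X)
    (k2 : X * S₂ = S₀ * X) (p0 : S₀ * P = P * S₀) (p2 : S₂ * P = P * S₂) :
    trace (X * (S₀ * S₁ * P)) = -trace (X * P) := by
  have e1 : S₀ * S₁ = S₁ * S₂ * (S₂ * S₀) := by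
    rw [c01, mul_assoc, ← mul_assoc S₂, q2]; simp
  have e2 : X * (S₁ * S₂) = S₂ * S₀ * X := by
    rw [← mul_assoc, k1, mul_assoc, k2, mul_assoc]
  have e3 : S₂ * S₀ * P = P * (S₂ * S₀) := by
    rw [mul_assoc, p0, ← mul_assoc, p2, mul_assoc]
  have e4 : S₂ * S₀ * (S₂ * S₀) = -1 := by
    rw [mul_assoc, ← mul_assoc S₀, c02, neg_mul, mul_neg, mul_assoc, q0, ← mul_assoc, q2]; simp
  rw [e1, mul_assoc, e3, ← mul_assoc X, e2, mul_assoc, trace_mul_comm, mul_assoc, mul_assoc, e4]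
  simp

/-- Averaging over the quaternion group of the lifts of the double transpositions
interchanging points of two three-cycles. -/
lemma IsAveraging.exists_succ {x : G} {F : Finset α} {P : Matrix m m ℂ} {k : ℕ}
    (h : D.IsAveraging x F P k) (hx : D.π x ^ 3 = 1) {a b a' b' a'' b'' : α}
    (ha : D.π x a = a') (hb : D.π x b = b') (ha' : D.π x a' = a'') (hb' : D.π x b' = b'')
    (hnd : [a, a', a'', b, b', b''].Nodup) (hF : ∀ y ∈ [a, a', a'', b, b', b''], y ∉ F) :
    ∃ P, D.IsAveraging x (F ∪ {a, a', a'', b, b', b''}) P (k + 1) := by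
  obtain ⟨h1, h2, h3⟩ := h
  obtain ⟨s, hs⟩ := D.surj (swap a b)
  have hs' : D.π (x * s * x⁻¹) = swap a' b' := by
    rw [map_mul, map_mul, hs, mul_swap_eq_swap_mul, map_inv, mul_assoc, mul_inv_cancel, mul_one,
      ha, hb]
  have hs'' : D.π (x * (x * s * x⁻¹) * x⁻¹) = swap a'' b'' := by
    rw [map_mul, map_mul, hs', mul_swap_eq_swap_mul, map_inv, mul_assoc, mul_inv_cancel, mul_one,
      ha', hb']
  have hs₃ : D.R (x * (x * (x * s * x⁻¹) * x⁻¹) * x⁻¹) = D.R s := by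
    rw [show x * (x * (x * s * x⁻¹) * x⁻¹) * x⁻¹ = x ^ 3 * s * (x ^ 3)⁻¹ by
      simp only [pow_succ, pow_zero, one_mul, _root_.mul_inv_rev, mul_assoc], map_mul, map_mul]
    have e := D.R_mul_inv (x ^ 3)
    rcases D.R_of_map_eq_one (x := x ^ 3) (by simpa using hx) with h | h <;> rw [h] at e ⊢
    · rw [one_mul] at e; simp [e]
    · rw [neg_one_mul] at e; rw [neg_one_mul, neg_mul, ← mul_neg, e, mul_one]
  have hn := hnd
  simp only [List.nodup_cons, List.mem_cons, not_or, List.not_mem_nil, not_false_eq_true,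
    and_true] at hn
  obtain ⟨⟨n1, n2, n3, n4, n5⟩, ⟨n6, n7, n8, n9⟩, ⟨n10, n11, n12⟩, ⟨n13, n14⟩, n15, -⟩ := hn
  simp only [List.forall_mem_cons] at hF
  obtain ⟨f1, f2, f3, f4, f5, f6, -⟩ := hF
  have q0 := D.swap_sq s a b n3 hs
  have q1 := D.swap_sq _ a' b' n8 hs'
  have q2 := D.swap_sq _ a'' b'' n12 hs''
  have c01 := D.swap_anticomm _ _ a b a' b' (by simp; tauto) hs hs'
  have c02 := D.swap_anticomm _ _ a b a'' b'' (by simp; tauto) hs hs''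
  have c12 := D.swap_anticomm _ _ a' b' a'' b'' (by simp; tauto) hs' hs''
  have p0 := h3 s a b n3 f1 f4 hs
  have p1 := h3 _ a' b' n8 f2 f5 hs'
  have p2 := h3 _ a'' b'' n12 f3 f6 hs''
  have hfar : ∀ t c d, c ≠ d → c ∉ F ∪ {a, a', a'', b, b', b''} →
      d ∉ F ∪ {a, a', a'', b, b', b''} → D.π t = swap c d →
      D.R t * P = P * D.R t ∧ D.R t * D.R s = -(D.R s * D.R t) ∧
      D.R t * D.R (x * s * x⁻¹) = -(D.R (x * s * x⁻¹) * D.R t) ∧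
      D.R t * D.R (x * (x * s * x⁻¹) * x⁻¹) = -(D.R (x * (x * s * x⁻¹) * x⁻¹) * D.R t) := by
    intro t c d hcd hc hd ht
    simp only [Finset.mem_union, Finset.mem_insert, Finset.mem_singleton, not_or] at hc hd
    exact ⟨h3 t c d hcd hc.1 hd.1 ht, D.swap_anticomm _ _ c d a b (by simp; tauto) ht hs,
      D.swap_anticomm _ _ c d a' b' (by simp; tauto) ht hs',
      D.swap_anticomm _ _ c d a'' b'' (by simp; tauto) ht hs''⟩
  have conj : ∀ y, D.R x * D.R y = D.R (x * y * x⁻¹) * D.R x := fun y => by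
    rw [← map_mul, ← map_mul, inv_mul_cancel_right]
  have k0 := conj s
  have k1 := conj (x * s * x⁻¹)
  have k2 := conj (x * (x * s * x⁻¹) * x⁻¹)
  rw [hs₃] at k2
  have adj : ∀ y, D.R y * D.R y = -1 → (D.R y)ᴴ = -D.R y := fun y hy => by
    rw [D.conjTranspose_R, ← mul_one (D.R y⁻¹), ← neg_neg (1 : Matrix m m ℂ), ← hy, mul_neg,
      R_inv_mul_cancel_left]
  have a0 := adj _ q0
  have a1 := adj _ q1
  have a2 := adj _ q2
  generalize D.R (x * (x * s * x⁻¹) * x⁻¹) = S₂ at *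
  generalize D.R (x * s * x⁻¹) = S₁ at *
  generalize D.R s = S₀ at *
  generalize hX : D.R x = X at *
  have t01 := trace_mul_quaternion (P := P) q0 q2 c01 c02 k1 k2 p0 p2
  have t12 := trace_mul_quaternion (P := P) q1 q0 c12 (by rw [c01, neg_neg]) k2 k0 p1 p0
  have t20 := trace_mul_quaternion (P := P) q2 q1 (by rw [c02, neg_neg]) (by rw [c12, neg_neg])
    k0 k1 p2 p1
  set Q := S₀ * S₁ + S₁ * S₂ + S₂ * S₀ with hQ
  have hQQ : Q * Q = -(3 : ℂ) • 1 := quaternion_sq q0 q1 q2 c01 c02 c12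
  have hQt : Qᴴ = -Q := by
    simp only [hQ, conjTranspose_add, conjTranspose_mul, a0, a1, a2, neg_mul_neg, neg_add]
    rw [c01, c12, c02, neg_neg, neg_neg]
  refine ⟨(1 / 4 : ℂ) • ((1 - Q) * P), ?_, ?_, ?_⟩
  · rw [hX, mul_smul_comm, trace_smul, sub_mul, one_mul, mul_sub, trace_sub, hQ, add_mul, add_mul,
      mul_add, mul_add, trace_add, trace_add, t01, t12, t20, h1, smul_eq_mul]
    ring
  · have hW : (1 - Q)ᴴ * (1 - Q) = (4 : ℂ) • 1 := by
      rw [conjTranspose_sub, hQt, conjTranspose_one, sub_neg_eq_add]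
      have : (1 + Q) * (1 - Q) = 1 - Q * Q := by noncomm_ring
      rw [this, hQQ]
      module
    rw [conjTranspose_smul, conjTranspose_mul, smul_mul_smul_comm, mul_assoc, ← mul_assoc _ _ P, hW,
      smul_mul_assoc, one_mul, mul_smul_comm, h2, smul_smul, smul_smul, pow_succ]
    congr 1
    simp
    ring
  · intro t c d hcd hc hd ht
    obtain ⟨e, e0, e1, e2⟩ := hfar t c d hcd hc hd ht
    have hpair : ∀ {A B : Matrix m m ℂ}, D.R t * A = -(A * D.R t) → D.R t * B = -(B * D.R t) →
        D.R t * (A * B) = A * B * D.R t := by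
      intro A B hA hB
      rw [← mul_assoc, hA, neg_mul, mul_assoc, hB, mul_neg, neg_neg, mul_assoc]
    have hQc : D.R t * Q = Q * D.R t := by
      rw [hQ, mul_add, mul_add, hpair e0 e1, hpair e1 e2, hpair e2 e0, add_mul, add_mul]
    rw [mul_smul_comm, smul_mul_assoc, ← mul_assoc, mul_sub, hQc, mul_assoc, ← e, mul_one,
      sub_mul, sub_mul, mul_assoc, one_mul]

end UnitarySpinRep

namespace UnitarySpinRep

section perm

variable {α : Type*} [DecidableEq α] [Fintype α]

lemma exists_formPerm_mul {σ : Perm α} {d : ℕ} (hd : 1 < d) (hσ : σ ^ d = 1) {u : α}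
    (hu : ∀ i, 0 < i → i < d → (σ ^ i) u ≠ u) :
    ∃ l : List α, ∃ σ₀ : Perm α, l.Nodup ∧ l.length = d ∧ (∀ x, x ∈ l ↔ σ.SameCycle u x) ∧
      σ = l.formPerm * σ₀ ∧ (∀ x ∈ l, σ₀ x = x) ∧ σ₀ ^ d = 1 := by
  have hσu : σ u ≠ u := hu 1 one_pos hd
  have hmem : ∀ x, x ∈ σ.toList u ↔ σ.SameCycle u x := fun x => by
    rw [Perm.mem_toList_iff, Perm.mem_support]; tauto
  have hpow : σ.cycleOf u ^ d = 1 := by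
    ext x
    by_cases hx : σ.SameCycle u x
    · rw [← Perm.SameCycle.cycleOf_eq hx.symm, Perm.cycleOf_pow_apply_self, hσ]
    · rw [Perm.pow_apply_eq_self_of_apply_eq_self]
      · rfl
      · exact Perm.cycleOf_apply_of_not_sameCycle hx
  have hcomm : Commute (σ.cycleOf u) σ :=
    Perm.self_mem_cycle_factors_commute
      (Perm.cycleOf_mem_cycleFactorsFinset_iff.2 (Perm.mem_support.2 hσu))
  refine ⟨σ.toList u, (σ.cycleOf u)⁻¹ * σ, Perm.nodup_toList _ _, ?_, hmem, ?_, ?_, ?_⟩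
  · rw [Perm.length_toList, ← (Perm.isCycle_cycleOf σ hσu).orderOf]
    refine le_antisymm (orderOf_le_of_pow_eq_one (by omega) hpow) ?_
    by_contra! hlt
    refine hu _ (orderOf_pos _) hlt ?_
    rw [← Perm.cycleOf_pow_apply_self, pow_orderOf_eq_one, Perm.one_apply]
  · rw [Perm.formPerm_toList, mul_inv_cancel_left]
  · intro x hx
    rw [hmem] at hx
    rw [Perm.mul_apply, Perm.inv_eq_iff_eq, hx.cycleOf_apply]
  · rw [hcomm.inv_left.mul_pow, inv_pow, hpow, hσ, inv_one, one_mul]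

end perm

variable {G α m : Type*} [Group G] [DecidableEq α] [Fintype α] [Fintype m] [DecidableEq m]
  {D : UnitarySpinRep G α m}

omit [Fintype α] in
lemma TraceBound.norm_trace_le {c l : Finset α} {A : ℝ} {x : G}
    (h : D.TraceBound c l (D.π x) A) : ‖trace (D.R x)‖ ≤ A * Fintype.card m := by
  simpa using h _ posFunctional_trace (tracial_trace c l) x rfl

lemma exists_eq_formPerm {σ : Perm α} {d : ℕ} (hd : 1 < d) (hσ : σ ^ d = 1) {u : α}
    (hu : ∀ i, 0 < i → i < d → (σ ^ i) u ≠ u) (hsame : ∀ x, σ.SameCycle u x) :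
    ∃ l : List α, l.Nodup ∧ l.length = d ∧ σ = l.formPerm := by
  obtain ⟨l, σ₀, hl, hlen, hmem, e, h₀, -⟩ := exists_formPerm_mul hd hσ hu
  refine ⟨l, hl, hlen, ?_⟩
  rw [e, show σ₀ = 1 from Perm.ext fun x => h₀ x ((hmem x).2 (hsame x)), mul_one]

lemma norm_trace_le_of_even [Nonempty m] {x : G} {i : ℕ} (hx : D.π x ^ (2 * i + 2) = 1) {u : α}
    (hu : ∀ j, 0 < j → j < 2 * i + 2 → (D.π x ^ j) u ≠ u)
    (hsame : ∀ y, (D.π x).SameCycle u y) :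
    ‖trace (D.R x)‖ ≤ Real.sqrt ((i + 1) / 4 ^ i) * Fintype.card m := by
  obtain ⟨l, hl, hlen, e⟩ := exists_eq_formPerm (by omega) hx hu hsame
  refine TraceBound.norm_trace_le (c := ∅) (l := l.toFinset) ?_
  rw [e]
  exact TraceBound.formPerm_of_even i l ∅ hlen hl (by simp)

lemma norm_trace_le_of_odd [Nonempty m] {x : G} {i : ℕ} (hx : D.π x ^ (2 * i + 5) = 1) {u : α}
    (hu : ∀ j, 0 < j → j < 2 * i + 5 → (D.π x ^ j) u ≠ u)
    (hsame : ∀ y, (D.π x).SameCycle u y) :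
    ‖trace (D.R x)‖ ≤ 29 / 100 * (1 / 2) ^ i * Fintype.card m := by
  obtain ⟨l, hl, hlen, e⟩ := exists_eq_formPerm (by omega) hx hu hsame
  refine TraceBound.norm_trace_le (c := ∅) (l := l.toFinset) ?_
  have := TraceBound.formPerm_mul_of_odd (D := D) zero_le_one odd_one (one_pow 1) i l ∅ hlen hl
    (by simp) (by simp) (by simp) (traceBound_one _ _ _)
  rwa [mul_one, mul_one, ← e] at this

lemma norm_trace_le_of_odd_of_not_sameCycle [Nonempty m] {x : G} {i : ℕ}
    (hx : D.π x ^ (2 * i + 5) = 1) {u v : α}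
    (hu : ∀ j, 0 < j → j < 2 * i + 5 → (D.π x ^ j) u ≠ u)
    (hv : ∀ j, 0 < j → j < 2 * i + 5 → (D.π x ^ j) v ≠ v) (huv : ¬(D.π x).SameCycle u v) :
    ‖trace (D.R x)‖ ≤ (29 / 100 * (1 / 2) ^ i) ^ 2 * Fintype.card m := by
  obtain ⟨l, σ₀, hl, hlen, hmem, e, h₀, hσ₀⟩ := exists_formPerm_mul (by omega) hx hu
  have hvl : v ∉ l := fun h => huv ((hmem v).1 h)
  have hpow : ∀ j : ℕ, (σ₀ ^ j) v = (D.π x ^ j) v := fun j => by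
    rw [e, (formPerm_commute h₀).eq, (formPerm_commute h₀).symm.mul_pow, Perm.mul_apply,
      Perm.pow_apply_eq_self_of_apply_eq_self (List.formPerm_apply_of_notMem hvl)]
  obtain ⟨l', σ₁, hl', hlen', hmem', e', h₁, hσ₁⟩ := exists_formPerm_mul (u := v) (by omega) hσ₀
    (fun j h1 h2 => by rw [hpow]; exact hv j h1 h2)
  have hll : ∀ y ∈ l, y ∉ l' := fun y hy hy' => by
    have h := ((hmem' y).1 hy').symm.eq_of_left (h₀ y hy)
    exact hvl (h ▸ hy)
  have h₁l : ∀ y ∈ l, σ₁ y = y := fun y hy => by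
    have := h₀ y hy
    rw [e', (formPerm_commute h₁).eq, Perm.mul_apply,
      List.formPerm_apply_of_notMem (hll y hy)] at this
    exact this
  have hodd : Odd (2 * i + 5) := ⟨i + 2, by ring⟩
  have b₁ := TraceBound.formPerm_mul_of_odd (D := D) zero_le_one hodd hσ₁ i l' l.toFinset hlen' hl'
    (Finset.disjoint_left.2 fun y hy hy' => hll y (List.mem_toFinset.1 hy) (List.mem_toFinset.1 hy'))
    (fun y hy => h₁l y (List.mem_toFinset.1 hy)) h₁ (traceBound_one _ _ _)
  rw [← e', mul_one] at b₁
  have b₂ := TraceBound.formPerm_mul_of_odd (D := D) (by positivity) hodd hσ₀ i l ∅ hlen hl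
    (by simp) (by simp) h₀ (b₁.mono fun w hw => ?_)
  · rw [← e, ← pow_two] at b₂
    exact b₂.norm_trace_le
  · exact ⟨fun y hy => hw.1 y (by simpa using hy), by simp⟩

end UnitarySpinRep

namespace UnitarySpinRep

/-- The permutation `σ` acts on the orbit of `u` with period exactly `n`, and the orbit of `u` is
everything. -/
structure IsRotation {α : Type*} (σ : Perm α) (u : α) (n : ℕ) : Prop where
  pow_apply_eq_iff : ∀ k, (σ ^ k) u = u ↔ n ∣ k
  exists_pow_apply : ∀ y, ∃ j : ℕ, (σ ^ j) u = y

namespace IsRotation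

variable {α : Type*} {σ : Perm α} {u : α} {n : ℕ}

lemma pow_apply_eq_pow_apply (h : IsRotation σ u n) {a b : ℕ} :
    (σ ^ a) u = (σ ^ b) u ↔ a ≡ b [MOD n] := by
  rcases le_total a b with hab | hab <;> obtain ⟨c, rfl⟩ := Nat.exists_eq_add_of_le hab
  · rw [pow_add, Perm.mul_apply, (σ ^ a).injective.eq_iff, eq_comm, h.pow_apply_eq_iff,
      Nat.modEq_iff_dvd' hab, Nat.add_sub_cancel_left]
  · rw [pow_add, Perm.mul_apply, (σ ^ b).injective.eq_iff, h.pow_apply_eq_iff, Nat.ModEq.comm,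
      Nat.modEq_iff_dvd' hab, Nat.add_sub_cancel_left]

lemma pow_eq_one (h : IsRotation σ u n) {k : ℕ} (hk : n ∣ k) : σ ^ k = 1 := by
  ext y
  obtain ⟨j, rfl⟩ := h.exists_pow_apply y
  rw [← Perm.mul_apply, ← pow_add, add_comm, pow_add, Perm.mul_apply,
    (h.pow_apply_eq_iff k).2 hk, Perm.one_apply]

lemma of_isCycle [DecidableEq α] [Fintype α] {σ : Perm α} (hσ : σ.IsCycle)
    (hs : σ.support = Finset.univ) (u : α) : IsRotation σ u (Fintype.card α) := by
  have hu : ∀ y, σ y ≠ y := fun y => Perm.mem_support.1 (hs ▸ Finset.mem_univ y)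
  refine ⟨fun k => ?_, fun y => hσ.exists_pow_eq (hu u) (hu y)⟩
  rw [← hσ.pow_eq_one_iff' (hu u), ← orderOf_dvd_iff_pow_eq_one, hσ.orderOf, hs, Finset.card_univ]

end IsRotation

lemma not_dvd_of_coprime {d e c k i : ℕ} (he : 0 < e) (hc : c.Coprime d) (hk : k = c * e)
    (h0 : 0 < i) (hi : i < d) : ¬d * e ∣ k * i := by
  rintro h
  rw [hk, mul_right_comm] at h
  exact Nat.not_dvd_of_pos_of_lt h0 hi
    (hc.symm.dvd_of_dvd_mul_left (Nat.dvd_of_mul_dvd_mul_right he h))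

lemma not_modEq_of_dvd {e n a b : ℕ} (he : 2 ≤ e) (hn : e ∣ n) (ha : e ∣ a) (hb : e ∣ b) :
    ¬a ≡ b + 1 [MOD n] := by
  intro h
  have h := h.of_dvd hn
  have := ((Nat.modEq_zero_iff_dvd.2 ha).symm.trans (h.trans
    ((Nat.modEq_zero_iff_dvd.2 hb).add_right 1))).symm
  rw [Nat.modEq_zero_iff_dvd] at this
  exact absurd (Nat.le_of_dvd (by omega) this) (by omega)

variable {G α m : Type*} [Group G] [DecidableEq α] [Fintype m] [DecidableEq m]
  {D : UnitarySpinRep G α m} {g : G} {u : α}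

lemma IsAveraging.norm_trace_le {x : G} {F : Finset α} {P : Matrix m m ℂ} {k : ℕ}
    (h : D.IsAveraging x F P k) : ‖trace (D.R x)‖ ≤ (1 / 2) ^ k * Fintype.card m := by
  have := (posFunctional_trace (m := m)).norm_le (B := D.R x * P) (δ := (1 / 2) ^ k) (by positivity)
    (by
      rw [conjTranspose_mul, mul_assoc, conjTranspose_R, R_inv_mul_cancel_left, h.2.1]
      push_cast
      rw [← pow_mul, mul_comm k, pow_mul]
      norm_num)
  simpa [h.1] using this

lemma trace_pow_eq_zero_of_even {d e k c : ℕ} (h : IsRotation (D.π g) u (d * e))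
    (he : 2 ≤ e) (hc : c.Coprime d) (hk : k = c * e) (hd : Even d) (hd0 : 0 < d) :
    trace (D.R (g ^ k)) = 0 := by
  have hek : e ∣ k := hk ▸ dvd_mul_left _ _
  have hpow : ∀ i a, ((D.π (g ^ k)) ^ i) ((D.π g ^ a) u) = (D.π g ^ (k * i + a)) u := fun i a => by
    rw [map_pow, ← pow_mul, ← Perm.mul_apply, ← pow_add]
  refine D.trace_eq_zero_of_even (a := (D.π g ^ 0) u) (b := (D.π g ^ 1) u) hd hd0 ?_ ?_
  · rw [map_pow, ← pow_mul]
    exact h.pow_eq_one ⟨c, by rw [hk]; ring⟩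
  · intro i h0 hi
    have hnd := not_dvd_of_coprime (by omega) hc hk h0 hi
    have hn : e ∣ d * e := dvd_mul_left _ _
    have hki : e ∣ k * i := hek.mul_right i
    have h1 : ¬0 ≡ k * i [MOD d * e] := fun h =>
      hnd (Nat.modEq_zero_iff_dvd.1 h.symm)
    have h2 : ¬1 ≡ k * i + 1 [MOD d * e] := fun h =>
      h1 (Nat.ModEq.add_right_cancel' 1 (by simpa using h))
    simp only [hpow, List.nodup_cons, List.mem_cons, List.not_mem_nil, or_false, not_or,
      h.pow_apply_eq_pow_apply, List.nodup_nil, not_false_eq_true, and_true]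
    refine ⟨⟨?_, h1, ?_⟩, ⟨?_, h2⟩, ?_⟩
    · exact not_modEq_of_dvd he hn (by simp) (by simp)
    · exact not_modEq_of_dvd he hn (by simp) hki
    · exact fun h => not_modEq_of_dvd (b := 0) he hn hki (by simp) h.symm
    · exact not_modEq_of_dvd he hn hki hki

variable [Fintype α] [Nonempty m]

lemma norm_trace_pow_le_of_odd {d e k c i : ℕ} (h : IsRotation (D.π g) u (d * e))
    (he : 2 ≤ e) (hc : c.Coprime d) (hk : k = c * e) (hd : d = 2 * i + 5) :
    ‖trace (D.R (g ^ k))‖ ≤ (29 / 100 * (1 / 2) ^ i) ^ 2 * Fintype.card m := by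
  have hek : e ∣ k := hk ▸ dvd_mul_left _ _
  have hpow : ∀ i a, ((D.π (g ^ k)) ^ i) ((D.π g ^ a) u) = (D.π g ^ (k * i + a)) u := fun i a => by
    rw [map_pow, ← pow_mul, ← Perm.mul_apply, ← pow_add]
  have hne : ∀ a j, 0 < j → j < 2 * i + 5 →
      (D.π (g ^ k) ^ j) ((D.π g ^ a) u) ≠ (D.π g ^ a) u := by
    intro a j h0 hj
    rw [hpow, Ne, h.pow_apply_eq_pow_apply]
    intro h'
    refine not_dvd_of_coprime (by omega) hc hk h0 (hd ▸ hj) (Nat.modEq_zero_iff_dvd.1 ?_)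
    exact Nat.ModEq.add_right_cancel' a (by simpa using h')
  refine norm_trace_le_of_odd_of_not_sameCycle ?_ (hne 0) (hne 1) ?_
  · rw [map_pow, ← pow_mul]
    exact h.pow_eq_one ⟨c, by rw [hk, ← hd]; ring⟩
  · intro h'
    obtain ⟨j, hj⟩ := h'.exists_nat_pow_eq
    rw [hpow, h.pow_apply_eq_pow_apply] at hj
    exact not_modEq_of_dvd (b := 0) he (dvd_mul_left _ _) (hek.mul_right j) (by simp) hj

omit [DecidableEq α] [Fintype α] in
lemma IsRotation.sameCycle_pow {σ : Perm α} {n k : ℕ} (h : IsRotation σ u n) (hk : k.Coprime n)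
    (y : α) : (σ ^ k).SameCycle u y := by
  obtain ⟨j, rfl⟩ := h.exists_pow_apply y
  have ho : orderOf σ ∣ n := orderOf_dvd_of_pow_eq_one (h.pow_eq_one dvd_rfl)
  obtain ⟨l, hl⟩ := exists_pow_eq_self_of_coprime (hk.symm.coprime_dvd_left ho).symm
  refine ⟨(l * j : ℕ), ?_⟩
  rw [zpow_natCast, pow_mul, hl]

omit [DecidableEq α] [Fintype α] in
lemma IsRotation.pow_pow_apply_ne {σ : Perm α} {n k j : ℕ} (h : IsRotation σ u n)
    (hk : k.Coprime n) (h0 : 0 < j) (hj : j < n) : ((σ ^ k) ^ j) u ≠ u := by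
  rw [← pow_mul, Ne, h.pow_apply_eq_iff]
  simpa using not_dvd_of_coprime one_pos hk (mul_one k).symm h0 hj

lemma norm_trace_pow_le_of_odd_of_coprime {n k i : ℕ} (h : IsRotation (D.π g) u n)
    (hk : k.Coprime n) (hn : n = 2 * i + 5) :
    ‖trace (D.R (g ^ k))‖ ≤ 29 / 100 * (1 / 2) ^ i * Fintype.card m := by
  refine norm_trace_le_of_odd (u := u) ?_ (fun j h0 hj => ?_) fun y => ?_
  · rw [map_pow, ← pow_mul]
    exact h.pow_eq_one (hn ▸ dvd_mul_left _ _)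
  · rw [map_pow]
    exact h.pow_pow_apply_ne hk h0 (hn ▸ hj)
  · rw [map_pow]
    exact h.sameCycle_pow hk y

lemma norm_trace_pow_le_of_even_of_coprime {n k i : ℕ} (h : IsRotation (D.π g) u n)
    (hk : k.Coprime n) (hn : n = 2 * i + 2) :
    ‖trace (D.R (g ^ k))‖ ≤ Real.sqrt ((i + 1) / 4 ^ i) * Fintype.card m := by
  refine norm_trace_le_of_even (u := u) ?_ (fun j h0 hj => ?_) fun y => ?_
  · rw [map_pow, ← pow_mul]
    exact h.pow_eq_one (hn ▸ dvd_mul_left _ _)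
  · rw [map_pow]
    exact h.pow_pow_apply_ne hk h0 (hn ▸ hj)
  · rw [map_pow]
    exact h.sameCycle_pow hk y

end UnitarySpinRep

namespace UnitarySpinRep

variable {G α m : Type*} [Group G] [DecidableEq α] [Fintype m] [DecidableEq m]
  {D : UnitarySpinRep G α m} {g : G} {u : α}

lemma exists_isAveraging_pow [Nonempty m] {q k c : ℕ} (h : IsRotation (D.π g) u (3 * q))
    (hc : c.Coprime 3) (hk : k = c * q) (M : ℕ) (hM : 2 * M ≤ q) :
    ∃ F P, D.IsAveraging (g ^ k) F P M ∧
      ∀ y ∈ F, ∃ j l, j < 2 * M ∧ y = (D.π g ^ (j + q * l)) u := by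
  induction M with
  | zero => exact ⟨∅, 1, D.isAveraging_one _, by simp⟩
  | succ M ih =>
    obtain ⟨F, P, hP, hF⟩ := ih (by omega)
    have hpow : ∀ a, (D.π (g ^ k)) ((D.π g ^ a) u) = (D.π g ^ (a + k)) u := fun a => by
      rw [map_pow, ← Perm.mul_apply, ← pow_add, add_comm]
    have hmod : ∀ {j j' l l' : ℕ}, j < q → j' < q → j ≠ j' →
        ¬j + q * l ≡ j' + q * l' [MOD 3 * q] := by
      intro j j' l l' hj hj' hne h'
      have := h'.of_dvd (dvd_mul_left q 3)
      simp only [Nat.ModEq, Nat.add_mul_mod_self_left, Nat.mod_eq_of_lt hj,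
        Nat.mod_eq_of_lt hj'] at this
      exact hne this
    have hself : ∀ {j i : ℕ}, 0 < i → i < 3 → ¬j ≡ j + k * i [MOD 3 * q] := by
      intro j i h0 hi h'
      refine not_dvd_of_coprime (by omega) hc hk h0 hi (Nat.modEq_zero_iff_dvd.1 ?_)
      exact Nat.ModEq.add_left_cancel' j (by simpa using h'.symm)
    have hk' : k = q * c := by rw [hk, mul_comm]
    have e1 : ∀ j, j = j + q * 0 := fun j => by ring
    have e2 : ∀ j, j + k = j + q * c := fun j => by rw [hk']
    have e3 : ∀ j, j + k + k = j + q * (2 * c) := fun j => by rw [hk']; ring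
    have s1 : ∀ j, ¬j ≡ j + k [MOD 3 * q] := fun j => by
      simpa using hself (j := j) (i := 1) (by omega) (by omega)
    have s2 : ∀ j, ¬j ≡ j + k + k [MOD 3 * q] := fun j => by
      simpa [mul_two, add_assoc] using hself (j := j) (i := 2) (by omega) (by omega)
    have ne : ∀ l l', ¬2 * M + q * l ≡ 2 * M + 1 + q * l' [MOD 3 * q] := fun l l' =>
      hmod (by omega) (by omega) (by omega)
    have hexp : ∀ y ∈ [(D.π g ^ (2 * M)) u, (D.π g ^ (2 * M + k)) u, (D.π g ^ (2 * M + k + k)) u,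
        (D.π g ^ (2 * M + 1)) u, (D.π g ^ (2 * M + 1 + k)) u, (D.π g ^ (2 * M + 1 + k + k)) u],
        ∃ j l, 2 * M ≤ j ∧ j < 2 * M + 2 ∧ y = (D.π g ^ (j + q * l)) u := by
      simp only [List.mem_cons, List.not_mem_nil, or_false]
      rintro y (rfl | rfl | rfl | rfl | rfl | rfl)
      · exact ⟨2 * M, 0, by omega, by omega, by rw [← e1]⟩
      · exact ⟨2 * M, c, by omega, by omega, by rw [← e2]⟩
      · exact ⟨2 * M, 2 * c, by omega, by omega, by rw [← e3]⟩
      · exact ⟨2 * M + 1, 0, by omega, by omega, by rw [← e1]⟩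
      · exact ⟨2 * M + 1, c, by omega, by omega, by rw [← e2]⟩
      · exact ⟨2 * M + 1, 2 * c, by omega, by omega, by rw [← e3]⟩
    obtain ⟨P', hP'⟩ := hP.exists_succ (a := (D.π g ^ (2 * M)) u) (b := (D.π g ^ (2 * M + 1)) u)
      (by rw [map_pow, ← pow_mul]; exact h.pow_eq_one ⟨c, by rw [hk]; ring⟩)
      (hpow _) (hpow _) (hpow _) (hpow _) (by
        simp only [List.nodup_cons, List.mem_cons, List.not_mem_nil, or_false, not_or,
          h.pow_apply_eq_pow_apply, List.nodup_nil, not_false_eq_true, and_true]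
        refine ⟨⟨s1 _, s2 _, ?_, ?_, ?_⟩, ⟨s1 _, ?_, ?_, ?_⟩, ⟨?_, ?_, ?_⟩, ⟨s1 _, s2 _⟩, s1 _⟩
        · simp
        · simpa [← e2] using ne 0 c
        · simpa [← e3] using ne 0 (2 * c)
        · simpa [← e2] using ne c 0
        · simpa [← e2] using ne c c
        · simpa [← e2, ← e3] using ne c (2 * c)
        · simpa [← e3] using ne (2 * c) 0
        · simpa [← e2, ← e3] using ne (2 * c) c
        · simpa [← e3] using ne (2 * c) (2 * c))
      (fun y hy hyF => by
        obtain ⟨j, l, hj, rfl⟩ := hF y hyF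
        obtain ⟨j', l', hj', hj'', e⟩ := hexp _ hy
        rw [h.pow_apply_eq_pow_apply] at e
        exact hmod (by omega) (by omega) (by omega) e)
    refine ⟨_, P', hP', fun y hy => ?_⟩
    rcases Finset.mem_union.1 hy with hy | hy
    · obtain ⟨j, l, hj, rfl⟩ := hF y hy
      exact ⟨j, l, by omega, rfl⟩
    · obtain ⟨j, l, -, hj, rfl⟩ := hexp y (by simpa using hy)
      exact ⟨j, l, by omega, rfl⟩

lemma norm_trace_pow_le_of_three [Nonempty m] {q k c : ℕ} (h : IsRotation (D.π g) u (3 * q))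
    (hc : c.Coprime 3) (hk : k = c * q) (M : ℕ) (hM : 2 * M ≤ q) :
    ‖trace (D.R (g ^ k))‖ ≤ (1 / 2) ^ M * Fintype.card m := by
  obtain ⟨F, P, hP, -⟩ := exists_isAveraging_pow h hc hk M hM
  exact hP.norm_trace_le

end UnitarySpinRep

namespace UnitarySpinRep

/-- The bound on the normalized character at a power of an `n`-cycle of order `d`. -/
def orderBound (n d : ℕ) : ℚ :=
  if d = n then
    if Even n then 14 / 100 * (11 / 20) ^ (n / 2 - 5) else 29 / 100 * (1 / 2) ^ ((n - 5) / 2)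
  else if Even d then 0
  else if d = 3 then if n < 18 then 1 / 4 else 1 / 8
  else (29 / 100 * (1 / 2) ^ ((d - 5) / 2)) ^ 2

lemma orderBound_nonneg (n d : ℕ) : 0 ≤ orderBound n d := by
  unfold orderBound
  split_ifs <;> positivity

lemma sqrt_le_geometric (j : ℕ) :
    Real.sqrt (((j + 4 : ℕ) + 1) / 4 ^ (j + 4)) ≤ 14 / 100 * (11 / 20) ^ j := by
  apply Real.sqrt_le_iff.2 ⟨by positivity, ?_⟩
  induction j with
  | zero => norm_num
  | succ j ih =>
    have e : (14 / 100 * (11 / 20) ^ (j + 1) : ℝ) ^ 2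
        = 121 / 400 * (14 / 100 * (11 / 20) ^ j) ^ 2 := by ring
    rw [e]
    refine le_trans ?_ (mul_le_mul_of_nonneg_left ih (by norm_num))
    rw [show j + 1 + 4 = (j + 4) + 1 by ring, pow_succ (4 : ℝ) (j + 4), mul_div_assoc',
      div_le_div_iff₀ (by positivity) (by positivity)]
    push_cast
    have h4 : (0 : ℝ) < 4 ^ (j + 4) := by positivity
    have hj : (0 : ℝ) ≤ j := by positivity
    nlinarith [mul_nonneg hj h4.le]

section

variable {G α m : Type*} [Group G] [DecidableEq α] [Fintype α] [Fintype m] [DecidableEq m]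
  [Nonempty m] {D : UnitarySpinRep G α m} {g : G} {u : α}

lemma norm_trace_pow_le_orderBound {n k : ℕ} (h : IsRotation (D.π g) u n) (hn : 10 ≤ n)
    (h0 : 0 < k) (hk : k < n) :
    ‖trace (D.R (g ^ k))‖ ≤ orderBound n (n / n.gcd k) * Fintype.card m := by
  obtain ⟨e, d, c, he, hdc, hn', hk'⟩ := Nat.exists_coprime' (m := n) (n := k)
    (Nat.gcd_pos_of_pos_right _ h0)
  have hg : n.gcd k = e := by
    rw [hn', hk', Nat.gcd_mul_right, hdc.gcd_eq_one, one_mul]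
  have hd : n / n.gcd k = d := by rw [hg, hn', Nat.mul_div_cancel _ he]
  rw [hd, orderBound]
  have hd0 : 0 < d := Nat.pos_of_ne_zero (by rintro rfl; omega)
  have hd1 : d ≠ 1 := by
    rintro rfl
    have : 0 < c := Nat.pos_of_ne_zero (by rintro rfl; omega)
    rw [hn', one_mul, hk'] at hk
    exact absurd (Nat.le_mul_of_pos_left e this) (by omega)
  by_cases hdn : d = n
  · rw [if_pos hdn]
    have hkn : k.Coprime n := by
      have he1 : e = 1 := Nat.eq_of_mul_eq_mul_left hd0 (by rw [← hn', mul_one, hdn])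
      rw [hk', he1, mul_one, ← hdn]
      exact hdc.symm
    split_ifs with hev
    · obtain ⟨i, hi⟩ := hev
      obtain ⟨j, rfl⟩ := Nat.exists_eq_add_of_le' (show 5 ≤ i by omega)
      refine (norm_trace_pow_le_of_even_of_coprime (i := j + 4) h hkn (by omega)).trans ?_
      rw [show n / 2 - 5 = j by omega]
      push_cast
      gcongr
      simpa using sqrt_le_geometric j
    · obtain ⟨i, hi⟩ := Nat.not_even_iff_odd.1 hev
      obtain ⟨j, rfl⟩ := Nat.exists_eq_add_of_le' (show 2 ≤ i by omega)
      refine (norm_trace_pow_le_of_odd_of_coprime (i := j) h hkn (by omega)).trans ?_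
      rw [show (n - 5) / 2 = j by omega]
      push_cast
      rfl
  rw [if_neg hdn]
  have he2 : 2 ≤ e := by
    by_contra!
    exact hdn (by rw [hn', show e = 1 by omega, mul_one])
  rw [hn'] at h
  split_ifs with hev h3 h18
  · rw [trace_pow_eq_zero_of_even h he2 hdc.symm hk' hev hd0]
    simp
  · subst h3
    refine (norm_trace_pow_le_of_three h hdc.symm hk' 2 (by omega)).trans ?_
    norm_num
  · subst h3
    refine (norm_trace_pow_le_of_three h hdc.symm hk' 3 (by omega)).trans ?_
    norm_num
  · obtain ⟨i, hi⟩ := Nat.not_even_iff_odd.1 hev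
    obtain ⟨j, rfl⟩ := Nat.exists_eq_add_of_le' (show 2 ≤ i by omega)
    refine (norm_trace_pow_le_of_odd (i := j) h he2 hdc.symm hk' (by omega)).trans ?_
    rw [show (d - 5) / 2 = j by omega]
    push_cast
    rfl

end

lemma card_filter_div_gcd_le (n d : ℕ) (hn : 0 < n) :
    ((Finset.Ico 1 n).filter fun k => n / n.gcd k = d).card ≤ d - 1 := by
  have : (Finset.Ico 1 n).filter (fun k => n / n.gcd k = d) ⊆
      (Finset.Ico 1 d).image fun j => j * (n / d) := by
    intro k hk
    simp only [Finset.mem_filter, Finset.mem_Ico] at hk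
    obtain ⟨⟨h1, h2⟩, h3⟩ := hk
    have hg0 : 0 < n.gcd k := Nat.gcd_pos_of_pos_left _ hn
    have hgn : d * n.gcd k = n := by rw [← h3]; exact Nat.div_mul_cancel (Nat.gcd_dvd_left _ _)
    have hd0 : 0 < d := Nat.pos_of_ne_zero (by rintro rfl; omega)
    have hnd : n / d = n.gcd k := Nat.div_eq_of_eq_mul_right hd0 hgn.symm
    obtain ⟨j, hj⟩ := Nat.gcd_dvd_right n k
    refine Finset.mem_image.2 ⟨j, Finset.mem_Ico.2 ⟨?_, ?_⟩, by rw [hnd, mul_comm, ← hj]⟩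
    · exact Nat.pos_of_ne_zero (by rintro rfl; omega)
    · by_contra! hle
      have := Nat.mul_le_mul_right (n.gcd k) hle
      rw [hgn, mul_comm, ← hj] at this
      omega
  refine (Finset.card_le_card this).trans (Finset.card_image_le.trans ?_)
  simp

/-- The bound at elements of order `d` different from the full cycle. -/
def properBound (d : ℕ) : ℚ :=
  if Even d then 0 else if d = 3 then 1 / 8 else (29 / 100 * (1 / 2) ^ ((d - 5) / 2)) ^ 2

lemma properBound_nonneg (d : ℕ) : 0 ≤ properBound d := by
  unfold properBound
  split_ifs <;> positivity

lemma sum_properBound_le (i : ℕ) :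
    ∑ d ∈ Finset.range (2 * i + 5), ((d - 1 : ℕ) : ℚ) * properBound d
      ≤ 1 / 4 + 841 / 10000 * (56 / 9 - (1 / 4) ^ i * (8 / 3 * i + 56 / 9)) := by
  induction i with
  | zero =>
    norm_num [Finset.sum_range_succ, properBound]
  | succ i ih =>
    rw [show 2 * (i + 1) + 5 = 2 * i + 5 + 1 + 1 by ring, Finset.sum_range_succ,
      Finset.sum_range_succ]
    have h1 : properBound (2 * i + 5) = (29 / 100 * (1 / 2) ^ i) ^ 2 := by
      rw [properBound, if_neg (by rw [Nat.not_even_iff_odd]; exact ⟨i + 2, by ring⟩),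
        if_neg (by omega), show (2 * i + 5 - 5) / 2 = i by omega]
    have h2 : properBound (2 * i + 5 + 1) = 0 := by
      rw [properBound, if_pos ⟨i + 3, by ring⟩]
    rw [h1, h2, mul_zero, add_zero, mul_pow, ← pow_mul, mul_comm i 2, pow_mul,
      show 2 * i + 5 - 1 = 2 * i + 4 by omega]
    refine (add_le_add_left ih _).trans (le_of_eq ?_)
    push_cast
    ring

lemma sum_properBound_le' (n : ℕ) :
    ∑ d ∈ Finset.range n, ((d - 1 : ℕ) : ℚ) * properBound d ≤ 1 / 4 + 841 / 10000 * (56 / 9) := by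
  refine (Finset.sum_le_sum_of_subset_of_nonneg
    (Finset.range_mono (show n ≤ 2 * n + 5 by omega)) fun d _ _ => ?_).trans
    ((sum_properBound_le n).trans ?_)
  · exact mul_nonneg (by positivity) (properBound_nonneg d)
  · have : (0 : ℚ) ≤ (1 / 4) ^ n * (8 / 3 * n + 56 / 9) := by positivity
    linarith

lemma orderBound_self_le {n : ℕ} (hn : 18 ≤ n) :
    ((n - 1 : ℕ) : ℚ) * orderBound n n ≤ 22 / 100 := by
  rw [orderBound, if_pos rfl]
  split_ifs with h
  · obtain ⟨i, hi⟩ := h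
    obtain ⟨j, rfl⟩ := Nat.exists_eq_add_of_le' (show 9 ≤ i by omega)
    rw [show n / 2 - 5 = j + 4 by omega, show n - 1 = 2 * j + 17 by omega]
    push_cast
    clear hi hn
    induction j with
    | zero => norm_num
    | succ j ih =>
      refine le_trans ?_ ih
      have hj : (0 : ℚ) ≤ j := by positivity
      have e : (11 / 20 : ℚ) ^ (j + 1 + 4) = 11 / 20 * (11 / 20) ^ (j + 4) := by ring
      have h4 : (0 : ℚ) < (11 / 20) ^ (j + 4) := by positivity
      rw [e]
      push_cast
      nlinarith [mul_nonneg hj h4.le]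
  · obtain ⟨i, hi⟩ := Nat.not_even_iff_odd.1 h
    obtain ⟨j, rfl⟩ := Nat.exists_eq_add_of_le' (show 9 ≤ i by omega)
    rw [show (n - 5) / 2 = j + 7 by omega, show n - 1 = 2 * j + 18 by omega]
    push_cast
    clear hi hn h
    induction j with
    | zero => norm_num
    | succ j ih =>
      refine le_trans ?_ ih
      have hj : (0 : ℚ) ≤ j := by positivity
      have e : (1 / 2 : ℚ) ^ (j + 1 + 7) = 1 / 2 * (1 / 2) ^ (j + 7) := by ring
      have h4 : (0 : ℚ) < (1 / 2) ^ (j + 7) := by positivity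
      rw [e]
      push_cast
      nlinarith [mul_nonneg hj h4.le]

lemma sum_orderBound_lt_one_of_lt {n : ℕ} (hn : 10 ≤ n) (hn' : n < 18) :
    ∑ k ∈ Finset.Ico 1 n, orderBound n (n / n.gcd k) < 1 := by
  interval_cases n <;> decide +kernel

lemma sum_orderBound_lt_one {n : ℕ} (hn : 10 ≤ n) :
    ∑ k ∈ Finset.Ico 1 n, orderBound n (n / n.gcd k) < 1 := by
  rcases lt_or_ge n 18 with h18 | h18
  · exact sum_orderBound_lt_one_of_lt hn h18
  calc ∑ k ∈ Finset.Ico 1 n, orderBound n (n / n.gcd k)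
      = ∑ d ∈ Finset.range (n + 1), ∑ k ∈ (Finset.Ico 1 n).filter fun k => n / n.gcd k = d,
          orderBound n (n / n.gcd k) := by
        refine (Finset.sum_fiberwise_of_maps_to (fun k _ => ?_) _).symm
        exact Finset.mem_range.2 (Nat.lt_succ_of_le (Nat.div_le_self _ _))
    _ ≤ ∑ d ∈ Finset.range (n + 1), ((d - 1 : ℕ) : ℚ) * orderBound n d := by
        refine Finset.sum_le_sum fun d _ => ?_
        rw [Finset.sum_congr rfl fun k hk => by rw [(Finset.mem_filter.1 hk).2],
          Finset.sum_const, nsmul_eq_mul]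
        exact mul_le_mul_of_nonneg_right (mod_cast card_filter_div_gcd_le n d (by omega))
          (orderBound_nonneg n d)
    _ = ∑ d ∈ Finset.range n, ((d - 1 : ℕ) : ℚ) * properBound d
          + ((n - 1 : ℕ) : ℚ) * orderBound n n := by
        rw [Finset.sum_range_succ]
        congr 1
        refine Finset.sum_congr rfl fun d hd => ?_
        rw [orderBound, properBound, if_neg (Finset.mem_range.1 hd).ne, if_neg (not_lt.2 h18)]
    _ ≤ 1 / 4 + 841 / 10000 * (56 / 9) + 22 / 100 :=
        add_le_add (sum_properBound_le' n) (orderBound_self_le h18)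
    _ < 1 := by norm_num

end UnitarySpinRep

namespace UnitarySpinRep

lemma cycleType_eq_of_pow_three {α : Type*} [DecidableEq α] [Fintype α] {k : ℕ}
    (hk : Fintype.card α = 3 * k) (hk0 : 0 < k) {σ : Perm α} (h : σ ^ 3 = 1) (hσ : ∀ x, σ x ≠ x) :
    σ.cycleType = Multiset.replicate k 3 := by
  have : Nonempty α := Fintype.card_pos_iff.1 (by omega)
  have ho : orderOf σ = 3 := orderOf_eq_prime h fun h1 => hσ (Classical.arbitrary α) (by rw [h1]; rfl)
  obtain ⟨n, hn⟩ := Perm.cycleType_prime_order (ho ▸ Nat.prime_three)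
  have hs : σ.support = Finset.univ := Finset.eq_univ_of_forall fun x => Perm.mem_support.2 (hσ x)
  have hsum := σ.sum_cycleType
  rw [hn, hs, Finset.card_univ, hk, ho, Multiset.sum_replicate, smul_eq_mul] at hsum
  rw [hn, ho, show n + 1 = k by omega]

lemma isConj_of_pow_three {σ τ : Perm (Fin 9)} (hσ : σ ^ 3 = 1) (hσ' : ∀ x, σ x ≠ x)
    (hτ : τ ^ 3 = 1) (hτ' : ∀ x, τ x ≠ x) : IsConj σ τ := by
  rw [Perm.isConj_iff_cycleType_eq, cycleType_eq_of_pow_three (k := 3) (by simp) (by simp) hσ hσ',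
    cycleType_eq_of_pow_three (k := 3) (by simp) (by simp) hτ hτ']

lemma exists_commuting_pow_three {f : Perm (Fin 9)} (hf : f ^ 3 = 1) (hf' : ∀ x, f x ≠ x) :
    ∃ v : Perm (Fin 9), v ^ 3 = 1 ∧ f * v = v * f ∧
      ∀ i j : Fin 3, (i, j) ≠ (0, 0) → ∀ x, (f ^ i.1 * v ^ j.1) x ≠ x := by
  have key : ∃ f₀ v₀ : Perm (Fin 9), f₀ ^ 3 = 1 ∧ (∀ x, f₀ x ≠ x) ∧ v₀ ^ 3 = 1 ∧
      f₀ * v₀ = v₀ * f₀ ∧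
      ∀ i j : Fin 3, (i, j) ≠ (0, 0) → ∀ x, (f₀ ^ i.1 * v₀ ^ j.1) x ≠ x :=
    ⟨c[0, 3, 6] * c[1, 4, 7] * c[2, 5, 8], c[0, 1, 2] * c[3, 4, 5] * c[6, 7, 8],
      by decide +kernel, by decide +kernel, by decide +kernel, by decide +kernel,
      by decide +kernel⟩
  obtain ⟨f₀, v₀, h1, h2, h3, h4, h5⟩ := key
  obtain ⟨w, rfl⟩ := isConj_iff.1 (isConj_of_pow_three h1 h2 hf hf')
  refine ⟨w * v₀ * w⁻¹, by rw [conj_pow, h3]; simp, ?_, fun i j hij x => ?_⟩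
  · rw [conj_mul, h4, conj_mul]
  · rw [conj_pow, conj_pow, conj_mul, Perm.mul_apply, Perm.mul_apply, Ne, ← Perm.eq_inv_iff_eq]
    exact h5 i j hij _

variable {G m : Type*} [Group G] [Fintype m] [DecidableEq m]

lemma trace_eq_of_pow_three [Nonempty m] {D : UnitarySpinRep G (Fin 9) m} {x y : G}
    (hx : D.π x ^ 3 = 1) (hx' : ∀ a, D.π x a ≠ a) (hx3 : D.R x ^ 3 = 1)
    (hy : D.π y ^ 3 = 1) (hy' : ∀ a, D.π y a ≠ a) (hy3 : D.R y ^ 3 = 1) :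
    trace (D.R x) = trace (D.R y) := by
  obtain ⟨w, hw⟩ := isConj_iff.1 (isConj_of_pow_three hx hx' hy hy')
  obtain ⟨s, rfl⟩ := D.surj w
  have : D.R (s * x * s⁻¹) = D.R y := D.R_eq_of_odd_pow (d := 3) (by decide) (by simpa using hw) (by
    rw [R_conj_pow, hx3, hy3, mul_one, R_mul_inv])
  rw [← this, map_mul, map_mul, trace_mul_comm, R_inv_mul_cancel_left]

lemma re_trace_ge_of_pow_three [Nonempty m] {D : UnitarySpinRep G (Fin 9) m} {x : G}
    (hx : D.π x ^ 3 = 1) (hx' : ∀ a, D.π x a ≠ a) (hx3 : D.R x ^ 3 = 1) :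
    -(Fintype.card m : ℝ) / 8 ≤ (trace (D.R x)).re := by
  obtain ⟨v, hv, hcomm, hfix⟩ := exists_commuting_pow_three hx hx'
  obtain ⟨y, rfl, hy3⟩ := D.exists_lift_pow_three hv
  have hRc : Commute (D.R x) (D.R y) := D.R_conj_of_odd_pow (d := 3) (by decide) hv hcomm
  have htr : ∀ i j : Fin 3, (i, j) ≠ (0, 0) →
      trace (D.R x ^ i.1 * D.R y ^ j.1) = trace (D.R x) := fun i j hij => by
    have hp : D.π (x ^ i.1 * y ^ j.1) = D.π x ^ i.1 * D.π y ^ j.1 := by simp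
    have hR : D.R (x ^ i.1 * y ^ j.1) = D.R x ^ i.1 * D.R y ^ j.1 := by simp
    rw [← hR]
    refine trace_eq_of_pow_three ?_ ?_ ?_ hx hx' hx3
    · rw [hp, Commute.mul_pow (Commute.pow_pow hcomm _ _), ← pow_mul, ← pow_mul, mul_comm, pow_mul,
        hx, mul_comm, pow_mul, hv, one_pow, one_pow, one_mul]
    · rw [hp]
      exact hfix i j hij
    · rw [hR, Commute.mul_pow (hRc.pow_pow _ _), ← pow_mul, ← pow_mul, mul_comm, pow_mul,
        hx3, mul_comm, pow_mul, hy3, one_pow, one_pow, one_mul]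
  have hadj : ∀ {s : G}, D.R s ^ 3 = 1 → (1 + D.R s + D.R s ^ 2)ᴴ = 1 + D.R s + D.R s ^ 2 ∧
      (1 + D.R s + D.R s ^ 2) * (1 + D.R s + D.R s ^ 2) = (3 : ℂ) • (1 + D.R s + D.R s ^ 2) := by
    intro s hs
    have hinv : D.R s⁻¹ = D.R s ^ 2 := by
      have := D.R_inv_mul_cancel_left s (D.R s ^ 2)
      rw [← pow_succ', hs, mul_one] at this
      exact this
    have h4 : D.R s ^ 4 = D.R s := by rw [pow_succ, hs, one_mul]
    constructor
    · rw [conjTranspose_add, conjTranspose_add, conjTranspose_pow, conjTranspose_R, hinv, ← pow_mul,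
        conjTranspose_one, h4]
      abel
    · have e1 : D.R s * D.R s ^ 2 = 1 := by rw [← pow_succ', hs]
      have e2 : D.R s ^ 2 * D.R s = 1 := by rw [← pow_succ, hs]
      have e3 : D.R s ^ 2 * D.R s ^ 2 = D.R s := by rw [← pow_add, h4]
      simp only [add_mul, mul_add, one_mul, mul_one, e1, e2, e3, ← sq (D.R s)]
      module
  obtain ⟨hA, hAA⟩ := hadj hx3
  obtain ⟨hB, hBB⟩ := hadj hy3
  set A := 1 + D.R x + D.R x ^ 2 with hAdef
  set B := 1 + D.R y + D.R y ^ 2 with hBdef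
  have hAB : A * B = B * A := by
    have h := hRc.pow_pow
    have e := fun i j => (h i j).eq
    have h11 := e 1 1
    have h12 := e 1 2
    have h21 := e 2 1
    simp only [pow_one] at h11 h12 h21
    simp only [hAdef, hBdef, add_mul, mul_add, one_mul, mul_one, h11, h12, h21, e 2 2]
    abel
  have hpos := posFunctional_trace (m := m) (A * B)
  have hsq : (A * B)ᴴ * (A * B) = (9 : ℂ) • (A * B) := by
    rw [conjTranspose_mul, hA, hB, mul_assoc, ← mul_assoc A A, hAA, smul_mul_assoc,
      mul_smul_comm, ← mul_assoc, ← hAB, mul_assoc, hBB, mul_smul_comm, smul_smul]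
    norm_num
  have hexp : trace (A * B) = Fintype.card m + 8 * trace (D.R x) := by
    have h01 := htr 0 1 (by decide)
    have h02 := htr 0 2 (by decide)
    have h10 := htr 1 0 (by decide)
    have h11 := htr 1 1 (by decide)
    have h12 := htr 1 2 (by decide)
    have h20 := htr 2 0 (by decide)
    have h21 := htr 2 1 (by decide)
    have h22 := htr 2 2 (by decide)
    simp only [Fin.val_zero, Fin.val_one, Fin.val_two, pow_zero, pow_one, one_mul, mul_one] at *
    simp only [add_mul, mul_add, one_mul, mul_one, trace_add, trace_one, *]
    ring
  rw [hsq, map_smul, traceLinearMap_apply, hexp, smul_eq_mul] at hpos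
  have hre := (Complex.le_def.1 hpos).1
  norm_num at hre
  linarith

end UnitarySpinRep

namespace UnitarySpinRep

variable {G m : Type*} [Group G] [Fintype m] [DecidableEq m] [Nonempty m]

lemma norm_eq_one_of_smul_R_pow {α : Type*} [DecidableEq α] {D : UnitarySpinRep G α m} {g : G}
    {n : ℕ} (hn : n ≠ 0) (hg : D.π g ^ n = 1) {μ : ℂ} (hμ : (μ • D.R g) ^ n = 1) : ‖μ‖ = 1 := by
  rw [smul_pow, ← map_pow] at hμ
  obtain ⟨i⟩ := ‹Nonempty m›
  have h1 : ‖μ ^ n‖ = 1 := by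
    rcases D.R_of_map_eq_one (x := g ^ n) (by simpa using hg) with h | h <;> rw [h] at hμ <;>
      have := congrFun (congrFun hμ i) i <;> simp at this
    · simp [this]
    · rw [← norm_neg, this, norm_one]
  rw [norm_pow] at h1
  exact (pow_eq_one_iff_of_nonneg (norm_nonneg _) hn).1 h1

omit [Nonempty m] in
lemma sum_pow_mul_trace_ne_zero_of_sum_lt {α : Type*} [DecidableEq α] {D : UnitarySpinRep G α m}
    {g : G} {n : ℕ} (hn : 0 < n) {μ : ℂ}
    (h : 0 < (Fintype.card m : ℝ) + ∑ k ∈ Finset.Ico 1 n, (μ ^ k * trace (D.R (g ^ k))).re) :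
    ∑ k ∈ Finset.range n, μ ^ k * trace (D.R (g ^ k)) ≠ 0 := by
  intro h0
  have := congrArg Complex.re h0
  rw [Finset.range_eq_Ico, Finset.sum_eq_sum_Ico_succ_bot hn] at this
  simp only [Complex.add_re, Complex.re_sum, Complex.zero_re, pow_zero, map_one, trace_one, one_mul,
    Complex.natCast_re, zero_add] at this
  linarith

lemma re_ge_of_norm_le {w z : ℂ} {c : ℝ} (hw : ‖w‖ = 1) (h : ‖z‖ ≤ c) : -c ≤ (w * z).re := by
  have := (abs_le.1 (Complex.abs_re_le_norm (w * z))).1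
  rw [norm_mul, hw, one_mul] at this
  linarith

lemma sum_pow_mul_trace_ne_zero_of_ten_le {α : Type*} [DecidableEq α] [Fintype α]
    {D : UnitarySpinRep G α m} {g : G} {u : α} {n : ℕ} (hn : 10 ≤ n) (h : IsRotation (D.π g) u n)
    {μ : ℂ} (hμ : (μ • D.R g) ^ n = 1) :
    ∑ k ∈ Finset.range n, μ ^ k * trace (D.R (g ^ k)) ≠ 0 := by
  have hnorm := norm_eq_one_of_smul_R_pow (by omega) (h.pow_eq_one dvd_rfl) hμ
  have hm : (0 : ℝ) < Fintype.card m := by exact_mod_cast Fintype.card_pos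
  refine sum_pow_mul_trace_ne_zero_of_sum_lt (by omega) ?_
  have h1 : ∑ k ∈ Finset.Ico 1 n, -((orderBound n (n / n.gcd k) : ℝ) * Fintype.card m)
      ≤ ∑ k ∈ Finset.Ico 1 n, (μ ^ k * trace (D.R (g ^ k))).re := by
    refine Finset.sum_le_sum fun k hk => ?_
    obtain ⟨hk1, hk2⟩ := Finset.mem_Ico.1 hk
    exact re_ge_of_norm_le (by rw [norm_pow, hnorm, one_pow])
      (norm_trace_pow_le_orderBound h hn hk1 hk2)
  have h2 : (∑ k ∈ Finset.Ico 1 n, (orderBound n (n / n.gcd k) : ℝ)) < 1 := by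
    exact_mod_cast sum_orderBound_lt_one hn
  rw [Finset.sum_neg_distrib, ← Finset.sum_mul] at h1
  nlinarith

lemma cube_root_cases {w : ℂ} (hw : w ^ 3 = 1) : w + w ^ 2 = 2 ∨ w + w ^ 2 = -1 := by
  have : (w - 1) * (w + w ^ 2 + 1) = 0 := by linear_combination hw
  rcases mul_eq_zero.1 this with h | h
  · left
    rw [sub_eq_zero.1 h]
    norm_num
  · right
    linear_combination h

lemma re_add_ge_of_pow_three {D : UnitarySpinRep G (Fin 9) m} {y : G}
    (hy : D.π y ^ 3 = 1) (hy' : ∀ a, D.π y a ≠ a)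
    (hb : ‖trace (D.R y)‖ ≤ 1 / 2 * Fintype.card m) {μ : ℂ} (hμ : (μ • D.R y) ^ 3 = 1) :
    -(Fintype.card m : ℝ) / 2 ≤ (μ * trace (D.R y) + μ ^ 2 * trace (D.R (y ^ 2))).re := by
  obtain ⟨x, hx, hx3⟩ := D.exists_lift_pow_three hy
  have hxx : D.π x ^ 3 = 1 := by rw [hx, hy]
  have hxx' : ∀ a, D.π x a ≠ a := by rwa [hx]
  obtain ⟨s, hs, hys⟩ : ∃ s : ℂ, s ^ 2 = 1 ∧ D.R y = s • D.R x := by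
    rcases D.fiber y x hx.symm with h | h
    · exact ⟨1, by norm_num, by rw [h, one_smul]⟩
    · exact ⟨-1, by norm_num, by rw [h, neg_smul, one_smul]⟩
  have hw : (μ * s) ^ 3 = 1 := by
    rw [hys, smul_smul, smul_pow, hx3] at hμ
    obtain ⟨i⟩ := ‹Nonempty m›
    simpa using congrFun (congrFun hμ i) i
  have hpow : ∀ a, D.π (x ^ 2) a ≠ a := fun a h => hxx' a (by
    have h1 : (D.π x ^ 2) a = a := by simpa using h
    have h2 : (D.π x ^ 3) a = a := by rw [hxx]; rfl
    rwa [pow_succ', Perm.mul_apply, h1] at h2)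
  have htr2 : trace (D.R (x ^ 2)) = trace (D.R x) :=
    trace_eq_of_pow_three (by rw [map_pow, ← pow_mul, mul_comm, pow_mul, hxx, one_pow]) hpow
      (by rw [map_pow, ← pow_mul, mul_comm, pow_mul, hx3, one_pow]) hxx hxx' hx3
  have hinv : D.R (x ^ 2) = (D.R x)ᴴ := by
    rw [conjTranspose_R]
    have := D.R_inv_mul_cancel_left x (D.R x ^ 2)
    rw [← pow_succ', hx3, mul_one] at this
    rw [map_pow, this]
  have hreal : (trace (D.R x)).im = 0 := by
    rw [hinv, trace_conjTranspose] at htr2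
    exact Complex.conj_eq_iff_im.1 htr2
  have hsum : μ * trace (D.R y) + μ ^ 2 * trace (D.R (y ^ 2))
      = (μ * s + (μ * s) ^ 2) * trace (D.R x) := by
    rw [map_pow, hys, smul_pow, ← map_pow, trace_smul, trace_smul, htr2, smul_eq_mul, smul_eq_mul]
    ring
  have hlow := re_trace_ge_of_pow_three hxx hxx' hx3
  have hup : |(trace (D.R x)).re| ≤ 1 / 2 * Fintype.card m := by
    refine (Complex.abs_re_le_norm _).trans (le_trans (le_of_eq ?_) hb)
    have : ‖s‖ = 1 := by
      rw [← pow_eq_one_iff_of_nonneg (norm_nonneg _) two_ne_zero, ← norm_pow, hs, norm_one]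
    rw [hys, trace_smul, norm_smul, this, one_mul]
  have hm : (0 : ℝ) < Fintype.card m := by exact_mod_cast Fintype.card_pos
  rw [hsum]
  rcases cube_root_cases hw with h | h <;> rw [h]
  · simp only [Complex.mul_re, Complex.re_ofNat, Complex.im_ofNat, zero_mul, sub_zero]
    linarith
  · simp only [Complex.mul_re, Complex.neg_re, Complex.one_re, Complex.neg_im, Complex.one_im,
      neg_zero, zero_mul, sub_zero]
    linarith [(abs_le.1 hup).2]

lemma sum_pow_mul_trace_ne_zero_of_nine {D : UnitarySpinRep G (Fin 9) m} {g : G} {u : Fin 9}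
    (h : IsRotation (D.π g) u 9) {μ : ℂ} (hμ : (μ • D.R g) ^ 9 = 1) :
    ∑ k ∈ Finset.range 9, μ ^ k * trace (D.R (g ^ k)) ≠ 0 := by
  have hnorm := norm_eq_one_of_smul_R_pow (by omega) (h.pow_eq_one dvd_rfl) hμ
  have hm : (0 : ℝ) < Fintype.card m := by exact_mod_cast Fintype.card_pos
  refine sum_pow_mul_trace_ne_zero_of_sum_lt (by omega) ?_
  have hc : ∀ k, k.Coprime 9 → -(29 / 400 * Fintype.card m) ≤ (μ ^ k * trace (D.R (g ^ k))).re :=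
    fun k hk => re_ge_of_norm_le (by rw [norm_pow, hnorm, one_pow])
      ((norm_trace_pow_le_of_odd_of_coprime (i := 2) h hk rfl).trans_eq (by ring))
  have h3 := re_add_ge_of_pow_three (D := D) (y := g ^ 3) (μ := μ ^ 3)
    (by rw [map_pow, ← pow_mul]; exact h.pow_eq_one dvd_rfl)
    (fun a => by
      obtain ⟨j, rfl⟩ := h.exists_pow_apply a
      rw [map_pow, ← Perm.mul_apply, ← pow_add, Ne, h.pow_apply_eq_pow_apply]
      intro h'
      have : 3 ≡ 0 [MOD 9] := Nat.ModEq.add_right_cancel' j (by rwa [zero_add])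
      exact absurd this (by decide))
    ((norm_trace_pow_le_of_three (q := 3) (c := 1) h (by decide) rfl 1 (by norm_num)).trans_eq
      (by ring))
    (by rw [map_pow, ← smul_pow, ← pow_mul]; exact hμ)
  rw [← pow_mul, ← pow_mul, Complex.add_re] at h3
  have h1 := hc 1 (by decide)
  have h2 := hc 2 (by decide)
  have h4 := hc 4 (by decide)
  have h5 := hc 5 (by decide)
  have h7 := hc 7 (by decide)
  have h8 := hc 8 (by decide)
  have key : ∀ f : ℕ → ℝ, ∑ k ∈ Finset.Ico 1 9, f k
      = f 1 + f 2 + f 3 + f 4 + f 5 + f 6 + f 7 + f 8 := fun f => by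
    simp [Finset.sum_Ico_succ_top]
  rw [key]
  rw [show 3 * 2 = 6 from rfl] at h3
  linarith

/-- The spectral projections of a lift of an `n`-cycle have nonzero trace. -/
lemma sum_pow_mul_trace_ne_zero {n : ℕ} (hn : 9 ≤ n) {D : UnitarySpinRep G (Fin n) m} {g : G}
    (hg : (D.π g).IsCycle) (hs : (D.π g).support = Finset.univ) {μ : ℂ}
    (hμ : (μ • D.R g) ^ n = 1) :
    ∑ k ∈ Finset.range n, μ ^ k * trace (D.R (g ^ k)) ≠ 0 := by
  have h := IsRotation.of_isCycle hg hs ⟨0, by omega⟩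
  rw [Fintype.card_fin] at h
  rcases hn.eq_or_lt with rfl | hn
  · exact sum_pow_mul_trace_ne_zero_of_nine h hμ
  · exact sum_pow_mul_trace_ne_zero_of_ten_le hn h hμ

end UnitarySpinRep

end spinRep

section coxeter

open Equiv

variable {Q : Type*} [Group Q] {s : ℕ → Q} {N : ℕ}

lemma mem_or_exists_of_mem_closure (hsq : ∀ i < N, s i * s i = 1)
    (hbr : ∀ i, i + 1 < N → s (i + 1) * s i * s (i + 1) = s i * s (i + 1) * s i)
    (hco : ∀ i j, i + 2 ≤ j → j < N → Commute (s i) (s j)) (k : ℕ) (hk : k < N) {x : Q}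
    (hx : x ∈ Subgroup.closure (s '' Set.Iio (k + 1))) :
    x ∈ Subgroup.closure (s '' Set.Iio k) ∨ ∃ a ∈ Subgroup.closure (s '' Set.Iio k),
      ∃ b ∈ Subgroup.closure (s '' Set.Iio k), x = a * s k * b := by
  induction k generalizing x with
  | zero =>
    have key : x = 1 ∨ x = s 0 := by
      have := hsq 0 hk
      induction hx using Subgroup.closure_induction_right with
      | one => simp
      | mul_right x _ y hy ih =>
        obtain ⟨i, hi, rfl⟩ := hy
        obtain rfl : i = 0 := by simpa using hi
        rcases ih with rfl | rfl <;> simp [this]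
      | mul_inv_cancel x _ y hy ih =>
        obtain ⟨i, hi, rfl⟩ := hy
        obtain rfl : i = 0 := by simpa using hi
        rcases ih with rfl | rfl <;> simp [inv_eq_of_mul_eq_one_left this, this]
    rcases key with rfl | rfl
    · exact Or.inl (one_mem _)
    · exact Or.inr ⟨1, one_mem _, 1, one_mem _, by simp⟩
  | succ k ih =>
    have hmul : ∀ x, (x ∈ Subgroup.closure (s '' Set.Iio (k + 1)) ∨
        ∃ a ∈ Subgroup.closure (s '' Set.Iio (k + 1)),
        ∃ b ∈ Subgroup.closure (s '' Set.Iio (k + 1)), x = a * s (k + 1) * b) → ∀ i < k + 2,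
        x * s i ∈ Subgroup.closure (s '' Set.Iio (k + 1)) ∨
        ∃ a ∈ Subgroup.closure (s '' Set.Iio (k + 1)),
        ∃ b ∈ Subgroup.closure (s '' Set.Iio (k + 1)), x * s i = a * s (k + 1) * b := by
      intro x hx i hi
      rcases Nat.lt_or_ge i (k + 1) with hik | hik
      · have hs : s i ∈ Subgroup.closure (s '' Set.Iio (k + 1)) :=
          Subgroup.subset_closure ⟨i, hik, rfl⟩
        rcases hx with hx | ⟨a, ha, b, hb, rfl⟩
        · exact Or.inl (mul_mem hx hs)
        · exact Or.inr ⟨a, ha, b * s i, mul_mem hb hs, by group⟩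
      · obtain rfl : i = k + 1 := by omega
        rcases hx with hx | ⟨a, ha, b, hb, rfl⟩
        · exact Or.inr ⟨x, hx, 1, one_mem _, by simp⟩
        have hcomm : ∀ c ∈ Subgroup.closure (s '' Set.Iio k), Commute c (s (k + 1)) := by
          intro c hc
          induction hc using Subgroup.closure_induction with
          | mem c hc =>
            obtain ⟨j, hj, rfl⟩ := hc
            exact hco j (k + 1) (by have := Set.mem_Iio.1 hj; omega) hk
          | one => exact Commute.one_left _
          | mul c d _ _ hc hd => exact hc.mul_left hd
          | inv c _ hc => exact hc.inv_left
        have hle : Subgroup.closure (s '' Set.Iio k) ≤ Subgroup.closure (s '' Set.Iio (k + 1)) :=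
          Subgroup.closure_mono (Set.image_mono (Set.Iio_subset_Iio (by omega)))
        have hsk : s k ∈ Subgroup.closure (s '' Set.Iio (k + 1)) :=
          Subgroup.subset_closure ⟨k, Nat.lt_succ_self k, rfl⟩
        rcases ih (by omega) hb with hb' | ⟨c, hc, d, hd, rfl⟩
        · left
          rw [mul_assoc, (hcomm b hb').eq, mul_assoc, ← mul_assoc (s (k + 1)), hsq _ hk, one_mul]
          exact mul_mem ha hb
        · right
          refine ⟨a * (c * s k), mul_mem ha (mul_mem (hle hc) hsk), s k * d,
            mul_mem hsk (hle hd), ?_⟩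
          calc a * s (k + 1) * (c * s k * d) * s (k + 1)
              = a * (s (k + 1) * c) * s k * (d * s (k + 1)) := by group
            _ = a * c * (s (k + 1) * s k * s (k + 1)) * d := by
                rw [← (hcomm c hc).eq, (hcomm d hd).eq]; group
            _ = _ := by rw [hbr k hk]; group
    induction hx using Subgroup.closure_induction_right with
    | one => exact Or.inl (one_mem _)
    | mul_right x _ y hy ih' =>
      obtain ⟨i, hi, rfl⟩ := hy
      exact hmul x ih' i hi
    | mul_inv_cancel x _ y hy ih' =>
      obtain ⟨i, hi, rfl⟩ := hy
      rw [inv_eq_of_mul_eq_one_left (hsq i (by have := Set.mem_Iio.1 hi; omega))]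
      exact hmul x ih' i hi

/-- A group satisfying the Coxeter relations of type `A` maps injectively to the symmetric
group. -/
lemma eq_one_of_coxeter (hsq : ∀ i < N, s i * s i = 1)
    (hbr : ∀ i, i + 1 < N → s (i + 1) * s i * s (i + 1) = s i * s (i + 1) * s i)
    (hco : ∀ i j, i + 2 ≤ j → j < N → Commute (s i) (s j)) {α : Type*} [DecidableEq α]
    (φ : Q →* Perm α) {p : ℕ → α} (hp : Set.InjOn p (Set.Iic N))
    (hφ : ∀ i < N, φ (s i) = swap (p i) (p (i + 1))) (k : ℕ) (hk : k ≤ N) {x : Q}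
    (hx : x ∈ Subgroup.closure (s '' Set.Iio k)) (h : φ x = 1) : x = 1 := by
  induction k with
  | zero => simpa using hx
  | succ k ih =>
    rcases mem_or_exists_of_mem_closure hsq hbr hco k hk hx with hx | ⟨a, ha, b, hb, rfl⟩
    · exact ih (by omega) hx
    have hne : ∀ i j, i ≤ N → j ≤ N → i ≠ j → p i ≠ p j := fun i j hi hj hij h => hij (hp hi hj h)
    have hfix : ∀ c ∈ Subgroup.closure (s '' Set.Iio k), φ c (p (k + 1)) = p (k + 1) := by
      intro c hc
      induction hc using Subgroup.closure_induction with
      | mem c hc =>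
        obtain ⟨j, hj, rfl⟩ := hc
        have := Set.mem_Iio.1 hj
        rw [hφ j (by omega), swap_apply_of_ne_of_ne (hne _ _ hk (by omega) (by omega))
          (hne _ _ hk (by omega) (by omega))]
      | one => simp
      | mul c d _ _ hc hd => rw [map_mul, Perm.mul_apply, hd, hc]
      | inv c _ hc => rw [map_inv, Perm.inv_eq_iff_eq, hc]
    have h1 : φ (a * s k * b) (p (k + 1)) = p (k + 1) := by rw [h]; rfl
    rw [map_mul, map_mul, Perm.mul_apply, Perm.mul_apply, hfix b hb, hφ k (by omega),
      swap_apply_right] at h1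
    exact absurd ((φ a).injective (h1.trans (hfix a ha).symm)) (hne k (k + 1) (by omega) hk (by omega))

end coxeter

section unitary

open Matrix
open scoped ComplexOrder MatrixOrder

variable {m G : Type*} [Fintype m] [DecidableEq m]

lemma Matrix.PosSemidef.exists_eq_conjTranspose_mul_self {P : Matrix m m ℂ} (hP : P.PosSemidef) :
    ∃ B : Matrix m m ℂ, P = Bᴴ * B :=
  CStarAlgebra.nonneg_iff_eq_star_mul_self.1 hP.nonneg

/-- A complex matrix representation of a finite group is conjugate to a unitary one. -/
lemma exists_conj_conjTranspose_eq [Group G] [Finite G] (A : G →* Matrix m m ℂ) :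
    ∃ B C : Matrix m m ℂ, B * C = 1 ∧ C * B = 1 ∧
      ∀ g, (B * A g * C)ᴴ = B * A g⁻¹ * C := by
  classical
  have := Fintype.ofFinite G
  set S := ∑ g, (A g)ᴴ * A g with hS
  have hpos : S.PosDef := by
    rw [hS, ← Finset.add_sum_erase _ _ (Finset.mem_univ (1 : G)), map_one, mul_one,
      conjTranspose_one]
    exact PosDef.one.add_posSemidef
      (posSemidef_sum _ fun g _ => posSemidef_conjTranspose_mul_self (A g))
  have hinv : ∀ g, (A g)ᴴ * S = S * A g⁻¹ := fun g => by
    rw [hS, Finset.mul_sum, Finset.sum_mul,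
      ← Equiv.sum_comp (Equiv.mulRight g) fun h => (A h)ᴴ * A h * A g⁻¹]
    refine Finset.sum_congr rfl fun h _ => ?_
    simp only [Equiv.coe_mulRight, map_mul, conjTranspose_mul, mul_assoc]
    rw [← map_mul A g g⁻¹, mul_inv_cancel, map_one, mul_one]
  obtain ⟨B, hB⟩ := hpos.posSemidef.exists_eq_conjTranspose_mul_self
  have hdet : IsUnit B.det := by
    have := hpos.det_pos.ne'
    rw [hB, det_mul] at this
    exact (right_ne_zero_of_mul this).isUnit
  refine ⟨B, B⁻¹, mul_nonsing_inv _ hdet, nonsing_inv_mul _ hdet, fun g => ?_⟩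
  have h := hinv g
  rw [hB] at h
  have h1 : (B⁻¹)ᴴ * Bᴴ = 1 := by
    rw [← conjTranspose_mul, mul_nonsing_inv _ hdet, conjTranspose_one]
  calc (B * A g * B⁻¹)ᴴ = (B⁻¹)ᴴ * ((A g)ᴴ * (Bᴴ * B)) * B⁻¹ := by
        rw [conjTranspose_mul, conjTranspose_mul]
        simp only [mul_assoc, mul_nonsing_inv _ hdet, mul_one]
    _ = ((B⁻¹)ᴴ * Bᴴ) * (B * A g⁻¹ * B⁻¹) := by rw [h]; simp only [mul_assoc]
    _ = _ := by rw [h1, one_mul]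

end unitary

lemma braid_of_pow_three {Q : Type*} [Group Q] {a b : Q} (ha : a * a = 1) (hb : b * b = 1)
    (h : (a * b) ^ 3 = 1) : b * a * b = a * b * a := by
  have ha' := inv_eq_of_mul_eq_one_left ha
  have hb' := inv_eq_of_mul_eq_one_left hb
  rw [pow_three] at h
  rw [eq_comm, ← mul_inv_eq_one, mul_inv_rev, mul_inv_rev, ha', hb', ← h]
  simp only [mul_assoc]

lemma commute_of_sq {Q : Type*} [Group Q] {a b : Q} (ha : a * a = 1) (hb : b * b = 1)
    (h : (a * b) ^ 2 = 1) : Commute a b := by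
  have ha' := inv_eq_of_mul_eq_one_left ha
  have hb' := inv_eq_of_mul_eq_one_left hb
  rw [sq] at h
  rw [commute_iff_eq, ← inv_eq_of_mul_eq_one_left h, mul_inv_rev, ha', hb']

lemma exists_perm_map_eq {α : Type*} [Finite α] {l l' : List α} (hl : l.Nodup) (hl' : l'.Nodup)
    (h : l.length = l'.length) : ∃ σ : Equiv.Perm α, l.map σ = l' := by
  obtain ⟨σ, hσ⟩ := (Equiv.Perm.isMultiplyPretransitive α l.length).exists_smul_eq
    ⟨l.get, List.nodup_iff_injective_get.1 hl⟩
    ⟨l'.get ∘ Fin.cast h, (List.nodup_iff_injective_get.1 hl').comp (Fin.cast_injective h)⟩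
  refine ⟨σ, List.ext_get (by simpa using h) fun i hi hi' => ?_⟩
  have := DFunLike.congr_fun hσ ⟨i, by simpa using hi⟩
  simpa using this

namespace Schur

open Equiv

variable {n : ℕ}

lemma z_mul_z : z n * z n = 1 := by
  have : PresentedGroup.mk (rels n) (zf n ^ 2) = 1 := PresentedGroup.one_of_mem (Or.inl rfl)
  rwa [map_pow, sq] at this

lemma t_mul_t (i : Fin (n - 1)) : t n i * t n i = z n := by
  have : PresentedGroup.mk (rels n) (tf n i ^ 2 * (zf n)⁻¹) = 1 :=
    PresentedGroup.one_of_mem (Or.inr (Or.inl ⟨i, rfl⟩))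
  rw [map_mul, map_pow, map_inv, mul_inv_eq_one, sq] at this
  exact this

lemma t_mul_t_pow_three {i j : Fin (n - 1)} (h : (i : ℕ) + 1 = j) : (t n i * t n j) ^ 3 = z n := by
  have : PresentedGroup.mk (rels n) ((tf n i * tf n j) ^ 3 * (zf n)⁻¹) = 1 :=
    PresentedGroup.one_of_mem (Or.inr (Or.inr (Or.inl ⟨i, j, h, rfl⟩)))
  rw [map_mul, map_pow, map_inv, mul_inv_eq_one, map_mul] at this
  exact this

lemma t_mul_t_sq {i j : Fin (n - 1)} (h : (i : ℕ) + 2 ≤ j) : (t n i * t n j) ^ 2 = z n := by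
  have : PresentedGroup.mk (rels n) ((tf n i * tf n j) ^ 2 * (zf n)⁻¹) = 1 :=
    PresentedGroup.one_of_mem (Or.inr (Or.inr (Or.inr ⟨i, j, Or.inl h, rfl⟩)))
  rw [map_mul, map_pow, map_inv, mul_inv_eq_one, map_mul] at this
  exact this

lemma commute_z (x : Cover n) : Commute (z n) x := by
  have hx : x ∈ Subgroup.closure (Set.range (PresentedGroup.of (rels := rels n))) := by
    rw [PresentedGroup.closure_range_of]; trivial
  induction hx using Subgroup.closure_induction with
  | mem x hx =>
    obtain ⟨_ | i, rfl⟩ := hx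
    · exact Commute.refl _
    · change Commute (z n) (t n i)
      rw [← t_mul_t i]
      exact (Commute.refl _).mul_left (Commute.refl _)
  | one => exact Commute.one_right _
  | mul x y _ _ hx hy => exact hx.mul_right hy
  | inv x _ hx => exact hx.inv_right

instance : (Subgroup.zpowers (z n)).Normal :=
  ⟨fun x hx y => by
    obtain ⟨k, rfl⟩ := hx
    have : Commute (z n ^ k) y := (commute_z y).zpow_left k
    change y * z n ^ k * y⁻¹ ∈ _
    rw [← this.eq, mul_inv_cancel_right]
    exact ⟨k, rfl⟩⟩

lemma mem_zpowers_z {x : Cover n} (hx : x ∈ Subgroup.zpowers (z n)) : x = 1 ∨ x = z n := by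
  obtain ⟨k, rfl⟩ := hx
  change z n ^ k = 1 ∨ z n ^ k = z n
  rcases Int.even_or_odd' k with ⟨l, rfl | rfl⟩
  · left; rw [zpow_mul, zpow_two, z_mul_z, one_zpow]
  · right; rw [zpow_add, zpow_mul, zpow_two, z_mul_z, one_zpow, one_mul, zpow_one]

variable {π : Cover n →* Perm (Fin n)}

lemma eq_one_or_eq_z (hn : 0 < n) (hπt : ∀ i : Fin (n - 1), π (t n i) = adj n i) (hπz : π (z n) = 1)
    {x : Cover n} (hx : π x = 1) : x = 1 ∨ x = z n := by
  apply mem_zpowers_z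
  rw [← QuotientGroup.eq_one_iff]
  let φ : Cover n ⧸ Subgroup.zpowers (z n) →* Perm (Fin n) :=
    QuotientGroup.lift _ π (by
      rintro _ ⟨k, rfl⟩
      change π (z n ^ k) = 1
      rw [map_zpow, hπz, one_zpow])
  have hz : ((z n : Cover n) : Cover n ⧸ Subgroup.zpowers (z n)) = 1 :=
    (QuotientGroup.eq_one_iff (z n)).2 (Subgroup.mem_zpowers _)
  let s : ℕ → Cover n ⧸ Subgroup.zpowers (z n) := fun i =>
    if h : i < n - 1 then (t n ⟨i, h⟩ : Cover n) else 1
  have hs : ∀ i (h : i < n - 1), s i = (t n ⟨i, h⟩ : Cover n) := fun i h => dif_pos h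
  have hsq : ∀ i < n - 1, s i * s i = 1 := fun i h => by
    rw [hs i h, ← QuotientGroup.mk_mul, t_mul_t, hz]
  refine eq_one_of_coxeter (s := s) (N := n - 1) hsq ?_ ?_ φ
    (p := fun i => ⟨i % n, Nat.mod_lt _ hn⟩) ?_ ?_ (n - 1) le_rfl ?_ hx
  · intro i hi
    have h := t_mul_t_pow_three (n := n) (i := ⟨i, by omega⟩) (j := ⟨i + 1, hi⟩) rfl
    have h := congrArg (QuotientGroup.mk (s := Subgroup.zpowers (z n))) h
    rw [hz, QuotientGroup.mk_pow, QuotientGroup.mk_mul, ← hs, ← hs] at h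
    exact braid_of_pow_three (hsq i (by omega)) (hsq (i + 1) hi) h
  · intro i j hij hj
    have h := t_mul_t_sq (n := n) (i := ⟨i, by omega⟩) (j := ⟨j, hj⟩) hij
    have h := congrArg (QuotientGroup.mk (s := Subgroup.zpowers (z n))) h
    rw [hz, QuotientGroup.mk_pow, QuotientGroup.mk_mul, ← hs, ← hs] at h
    exact commute_of_sq (hsq i (by omega)) (hsq j hj) h
  · intro i hi j hj h
    have hi := Set.mem_Iic.1 hi
    have hj := Set.mem_Iic.1 hj
    simpa [Nat.mod_eq_of_lt (show i < n by omega), Nat.mod_eq_of_lt (show j < n by omega)] using h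
  · intro i hi
    rw [hs i hi]
    change π (t n ⟨i, hi⟩) = _
    rw [hπt, adj]
    simp only [Nat.mod_eq_of_lt (show i < n by omega), Nat.mod_eq_of_lt (show i + 1 < n by omega)]
  · refine PresentedGroup.generated_by _
      ((Subgroup.closure (s '' Set.Iio (n - 1))).comap (QuotientGroup.mk' _)) (fun j => ?_) x
    rw [Subgroup.mem_comap, QuotientGroup.mk'_apply]
    rcases j with _ | i
    · exact hz ▸ one_mem _
    · exact Subgroup.subset_closure ⟨i, i.2, hs i i.2⟩

lemma eq_or_eq_mul_z (hn : 0 < n) (hπt : ∀ i : Fin (n - 1), π (t n i) = adj n i)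
    (hπz : π (z n) = 1) {x y : Cover n} (h : π x = π y) : x = y ∨ x = y * z n := by
  rcases eq_one_or_eq_z hn hπt hπz (x := y⁻¹ * x) (by rw [map_mul, map_inv, h, inv_mul_cancel]) with
    h | h
  · exact Or.inl (inv_mul_eq_one.1 h).symm
  · exact Or.inr (inv_mul_eq_iff_eq_mul.1 h)

lemma finite_cover (hn : 0 < n) (hπt : ∀ i : Fin (n - 1), π (t n i) = adj n i)
    (hπz : π (z n) = 1) : Finite (Cover n) := by
  rw [← Set.finite_univ_iff]
  refine Set.Finite.of_finite_fibers π (Set.toFinite _) fun σ _ => ?_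
  rcases Set.eq_empty_or_nonempty (Set.univ ∩ π ⁻¹' {σ}) with h | ⟨y, -, hy⟩
  · rw [h]; exact Set.finite_empty
  · refine (Set.toFinite {y, y * z n}).subset fun x hx => ?_
    exact eq_or_eq_mul_z hn hπt hπz (hx.2.trans hy.symm)

lemma surjective_of_map_t (hn : 0 < n) (hπt : ∀ i : Fin (n - 1), π (t n i) = adj n i) :
    Function.Surjective π := by
  obtain ⟨n, rfl⟩ := Nat.exists_eq_add_of_le' hn
  rw [← MonoidHom.mrange_eq_top, ← top_le_iff, ← Perm.mclosure_swap_castSucc_succ,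
    Submonoid.closure_le]
  rintro _ ⟨i, rfl⟩
  exact ⟨t (n + 1) i, hπt i⟩

lemma mul_z_mul (x y : Cover n) : x * z n * y = x * y * z n := by
  rw [mul_assoc, (commute_z y).eq, mul_assoc]

lemma mul_z_mul_mul_z (x y : Cover n) : x * z n * (y * z n) = x * y := by
  rw [mul_z_mul, ← mul_assoc, mul_assoc _ (z n), z_mul_z, mul_one]

/-- Lifts of transpositions square to `z`. -/
lemma mul_self_eq_z_of_swap (hn : 2 ≤ n) (hπt : ∀ i : Fin (n - 1), π (t n i) = adj n i)
    (hπz : π (z n) = 1) {x : Cover n} {a b : Fin n} (hab : a ≠ b) (hx : π x = swap a b) :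
    x * x = z n := by
  obtain ⟨σ, hσ⟩ := exists_perm_map_eq (l := [(⟨0, by omega⟩ : Fin n), ⟨1, by omega⟩])
    (l' := [a, b]) (by simp) (by simpa using hab) rfl
  simp only [List.map_cons, List.map_nil, List.cons.injEq, and_true] at hσ
  obtain ⟨s, rfl⟩ := surjective_of_map_t (by omega) hπt σ
  have hconj : π x = π (s * t n ⟨0, by omega⟩ * s⁻¹) := by
    rw [hx, map_mul, map_mul, map_inv, hπt, adj, ← hσ.1, ← hσ.2, swap_apply_apply]
  have hsq : s * t n ⟨0, by omega⟩ * s⁻¹ * (s * t n ⟨0, by omega⟩ * s⁻¹) = z n := by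
    rw [conj_mul, t_mul_t, ← (commute_z s).eq, mul_inv_cancel_right]
  rcases eq_or_eq_mul_z (by omega) hπt hπz hconj with h | h <;> rw [h]
  · exact hsq
  · rw [mul_z_mul_mul_z, hsq]

lemma t_mul_t_eq_mul_z {i j : Fin (n - 1)} (h : (i : ℕ) + 2 ≤ j) :
    t n i * t n j = t n j * t n i * z n := by
  have h1 := t_mul_t_sq h
  rw [sq] at h1
  refine mul_left_cancel (a := t n i * t n j) (h1.trans ?_)
  rw [← mul_assoc, mul_assoc (t n i), ← mul_assoc (t n j), t_mul_t, (commute_z (t n i)).eq,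
    ← mul_assoc, t_mul_t, z_mul_z, one_mul]

/-- Lifts of disjoint transpositions commute up to the central factor `z`. -/
lemma mul_eq_mul_mul_z_of_swap (hn : 4 ≤ n) (hπt : ∀ i : Fin (n - 1), π (t n i) = adj n i)
    (hπz : π (z n) = 1) {x y : Cover n} {a b c d : Fin n} (hnd : [a, b, c, d].Nodup)
    (hx : π x = swap a b) (hy : π y = swap c d) : x * y = y * x * z n := by
  obtain ⟨σ, hσ⟩ := exists_perm_map_eq
    (l := [(⟨0, by omega⟩ : Fin n), ⟨1, by omega⟩, ⟨2, by omega⟩, ⟨3, by omega⟩]) (l' := [a, b, c, d])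
    (by simp) hnd rfl
  simp only [List.map_cons, List.map_nil, List.cons.injEq, and_true] at hσ
  obtain ⟨h0, h1, h2, h3⟩ := hσ
  obtain ⟨s, rfl⟩ := surjective_of_map_t (by omega) hπt σ
  have hconj (i : Fin (n - 1)) : π (s * t n i * s⁻¹) =
      swap (π s ⟨i, by omega⟩) (π s ⟨i + 1, by omega⟩) := by
    rw [map_mul, map_mul, map_inv, hπt, adj, swap_apply_apply]
  have hx' : π x = π (s * t n ⟨0, by omega⟩ * s⁻¹) := by rw [hx, hconj, ← h0, ← h1]
  have hy' : π y = π (s * t n ⟨2, by omega⟩ * s⁻¹) := by rw [hy, hconj, ← h2, ← h3]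
  have key : s * t n ⟨0, by omega⟩ * s⁻¹ * (s * t n ⟨2, by omega⟩ * s⁻¹) =
      s * t n ⟨2, by omega⟩ * s⁻¹ * (s * t n ⟨0, by omega⟩ * s⁻¹) * z n := by
    rw [conj_mul, conj_mul, t_mul_t_eq_mul_z le_rfl, mul_assoc _ s⁻¹, ← (commute_z s⁻¹).eq]
    simp only [mul_assoc]
  rcases eq_or_eq_mul_z (by omega) hπt hπz hx' with h | h <;>
  rcases eq_or_eq_mul_z (by omega) hπt hπz hy' with h' | h' <;> rw [h, h']
  · exact key
  · rw [← mul_assoc, key, mul_z_mul (s * t n ⟨2, by omega⟩ * s⁻¹)]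
  · rw [mul_z_mul, key, ← mul_assoc _ (s * t n ⟨0, by omega⟩ * s⁻¹)]
  · rw [mul_z_mul_mul_z, mul_z_mul_mul_z, key]

end Schur

section main

open Equiv Matrix Polynomial Schur

lemma Schur.exists_unitarySpinRep {n : ℕ} (hn : 4 ≤ n) {π : Cover n →* Perm (Fin n)}
    (hπt : ∀ i : Fin (n - 1), π (t n i) = adj n i) (hπz : π (z n) = 1) {m : Type*} [Fintype m]
    [DecidableEq m] {A : Cover n →* Matrix m m ℂ} (hA : A (z n) = -1) :
    ∃ D : UnitarySpinRep (Cover n) (Fin n) m,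
      D.π = π ∧ ∃ B C, B * C = 1 ∧ C * B = 1 ∧ ∀ x, D.R x = B * A x * C := by
  have := finite_cover (by omega) hπt hπz
  obtain ⟨B, C, hBC, hCB, hR⟩ := exists_conj_conjTranspose_eq A
  let R : Cover n →* Matrix m m ℂ :=
    { toFun x := B * A x * C
      map_one' := by rw [map_one, mul_one, hBC]
      map_mul' x y := by
        rw [map_mul, mul_assoc (B * A x), mul_assoc B (A y), ← mul_assoc C B, hCB, one_mul]
        simp only [mul_assoc] }
  have hRz : R (z n) = -1 := by
    change B * A (z n) * C = -1
    rw [hA, mul_neg, mul_one, neg_mul, hBC]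
  refine ⟨⟨π, R, surjective_of_map_t (by omega) hπt, fun x y h => ?_, hR, fun x a b hab hx => ?_,
    fun x y a b c d hnd hx hy => ?_⟩, rfl, B, C, hBC, hCB, fun _ => rfl⟩
  · rcases eq_or_eq_mul_z (by omega) hπt hπz h with rfl | rfl
    · exact Or.inl rfl
    · right; rw [map_mul, hRz, mul_neg, mul_one]
  · rw [← map_mul, mul_self_eq_z_of_swap (by omega) hπt hπz hab hx, hRz]
  · rw [← map_mul, mul_eq_mul_mul_z_of_swap hn hπt hπz hnd hx hy, map_mul, hRz, map_mul, mul_neg,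
      mul_one]

/-- If `f ^ n` is the scalar `ε`, then `l` is a root of the minimal polynomial of `f` as soon as
`l ^ n = ε` and the corresponding averaging operator is non-zero. -/
lemma minpoly_isRoot_of_sum_ne_zero {V : Type*} [AddCommGroup V] [Module ℂ V]
    [FiniteDimensional ℂ V] {f : Module.End ℂ V} {n : ℕ} {ε l : ℂ} (hl0 : l ≠ 0)
    (hf : f ^ n = algebraMap ℂ _ ε) (hl : l ^ n = ε)
    (h : ∑ k ∈ Finset.range n, (l⁻¹ • f) ^ k ≠ 0) : (minpoly ℂ f).IsRoot l := by
  rw [← Module.End.hasEigenvalue_iff_isRoot]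
  obtain ⟨v, hv⟩ : ∃ v, (∑ k ∈ Finset.range n, (l⁻¹ • f) ^ k) v ≠ 0 := by
    by_contra! hv
    exact h (LinearMap.ext hv)
  refine Module.End.hasEigenvalue_of_hasEigenvector (x := (∑ k ∈ Finset.range n, (l⁻¹ • f) ^ k) v)
    ⟨?_, hv⟩
  rw [Module.End.mem_eigenspace_iff]
  have h1 : (l⁻¹ • f) * (∑ k ∈ Finset.range n, (l⁻¹ • f) ^ k) =
      ∑ k ∈ Finset.range n, (l⁻¹ • f) ^ k := by
    rw [← sub_eq_zero, ← sub_one_mul, mul_geom_sum, _root_.smul_pow, hf, ← hl, inv_pow,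
      Algebra.smul_def, ← map_mul, inv_mul_cancel₀ (pow_ne_zero n hl0), map_one, sub_self]
  have h2 := LinearMap.congr_fun h1 v
  rw [smul_mul_assoc, LinearMap.smul_apply, inv_smul_eq_iff₀ hl0] at h2
  exact h2

lemma minpoly_eq_X_pow_sub_C {V : Type*} [AddCommGroup V] [Module ℂ V]
    [FiniteDimensional ℂ V] {f : Module.End ℂ V} {n : ℕ} (hn : n ≠ 0) {ε : ℂ} (hε : ε ≠ 0)
    (hf : f ^ n = algebraMap ℂ _ ε)
    (h : ∀ l : ℂ, l ^ n = ε → ∑ k ∈ Finset.range n, (l⁻¹ • f) ^ k ≠ 0) :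
    minpoly ℂ f = X ^ n - C ε ∧ (spectrum ℂ f).ncard = n := by
  have hsep : (X ^ n - C ε : ℂ[X]).Separable :=
    separable_X_pow_sub_C ε (Nat.cast_ne_zero.2 hn) hε
  have hmonic : (X ^ n - C ε : ℂ[X]).Monic := monic_X_pow_sub_C ε hn
  have hfi : IsIntegral ℂ f := Algebra.IsIntegral.isIntegral f
  have hdvd : minpoly ℂ f ∣ X ^ n - C ε :=
    minpoly.dvd _ _ (by rw [map_sub, map_pow, aeval_X, aeval_C, hf, sub_self])
  have hroot : ∀ l : ℂ, (X ^ n - C ε : ℂ[X]).IsRoot l → (minpoly ℂ f).IsRoot l := fun l hl => by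
    have hl : l ^ n = ε := by simpa [sub_eq_zero] using hl
    refine minpoly_isRoot_of_sum_ne_zero ?_ hf hl (h l hl)
    rintro rfl
    exact hε (by rw [← hl, zero_pow hn])
  have hmin : minpoly ℂ f = X ^ n - C ε := by
    refine eq_of_monic_of_associated (minpoly.monic hfi) hmonic (associated_of_dvd_dvd hdvd ?_)
    rw [(IsAlgClosed.splits _).dvd_iff_roots_le_roots hmonic.ne_zero (minpoly.ne_zero hfi)]
    refine (Multiset.le_iff_subset (nodup_roots hsep)).2 fun l hl => ?_
    exact (mem_roots (minpoly.ne_zero hfi)).2 (hroot l (isRoot_of_mem_roots hl))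
  refine ⟨hmin, ?_⟩
  have hspec : spectrum ℂ f = (X ^ n - C ε : ℂ[X]).rootSet ℂ := by
    ext l
    rw [← Module.End.hasEigenvalue_iff_mem_spectrum, Module.End.hasEigenvalue_iff_isRoot, hmin,
      mem_rootSet_of_ne hmonic.ne_zero]
    simp
  rw [hspec, Set.ncard_eq_toFinset_card', Set.toFinset_card,
    card_rootSet_eq_natDegree hsep (IsAlgClosed.splits _), natDegree_X_pow_sub_C]

end main

open Schur Polynomial in
/-- Theorem: for `n ≥ 9` and `g ∈ S̃_n` projecting to an `n`-cycle, the minimal polynomial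
of `ρ(g)` in every irreducible spin representation `(ρ, V)` of Schur's double cover `S̃_n`
is `X^n − ε_g`; in particular `ρ(g)` has exactly `n` distinct eigenvalues. -/
theorem schur_minpoly_of_n_cycle (n : ℕ) (hn : 9 ≤ n)
    (π : Cover n →* Equiv.Perm (Fin n))
    (hπt : ∀ i : Fin (n - 1), π (t n i) = adj n i)
    (hπz : π (z n) = 1)
    (g : Cover n) (hcyc : (π g).IsCycle) (hsupp : (π g).support = Finset.univ)
    (V : Type) [AddCommGroup V] [Module ℂ V] [FiniteDimensional ℂ V] [Nontrivial V]
    (ρ : Cover n →* Module.End ℂ V)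
    (hirr : ∀ U : Submodule ℂ V, (∀ h : Cover n, U.map (ρ h) ≤ U) → U = ⊥ ∨ U = ⊤)
    (hspin : ρ (z n) = -1)
    (ε : ℂ) (hε : (g ^ n = 1 ∧ ε = 1) ∨ (g ^ n = z n ∧ ε = -1)) :
    minpoly ℂ (ρ g) = X ^ n - C ε ∧ (spectrum ℂ (ρ g)).ncard = n := by
  have hε0 : ε ≠ 0 := by rcases hε with h | h <;> simp [h.2]
  have hpow : ρ g ^ n = algebraMap ℂ _ ε := by
    rcases hε with ⟨h, rfl⟩ | ⟨h, rfl⟩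
    · rw [← map_pow, h, map_one, map_one]
    · rw [← map_pow, h, hspin, map_neg, map_one]
  refine minpoly_eq_X_pow_sub_C (by omega) hε0 hpow fun l hl hsum => ?_
  have hl0 : l ≠ 0 := by
    rintro rfl
    exact hε0 (by rw [← hl, zero_pow (by omega)])
  have : Nonempty (Fin (Module.finrank ℂ V)) := ⟨⟨0, Module.finrank_pos⟩⟩
  let M := LinearMap.toMatrixAlgEquiv (Module.finBasis ℂ V)
  obtain ⟨D, rfl, B, C, hBC, hCB, hR⟩ := exists_unitarySpinRep (by omega) hπt hπz
    (A := (MonoidHomClass.toMonoidHom M).comp ρ)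
    (by change M (ρ (z n)) = -1; rw [hspin, map_neg, map_one])
  replace hR (x : Cover n) : D.R x = B * M (ρ x) * C := hR x
  have hRpow : (l⁻¹ • D.R g) ^ n = 1 := by
    rw [_root_.smul_pow, ← map_pow, hR, map_pow, hpow, AlgEquiv.commutes, ← hl, Algebra.algebraMap_eq_smul_one,
      mul_smul_comm, smul_mul_assoc, mul_one, hBC, smul_smul, ← mul_pow, inv_mul_cancel₀ hl0,
      one_pow, one_smul]
  refine UnitarySpinRep.sum_pow_mul_trace_ne_zero hn hcyc hsupp hRpow ?_
  calc ∑ k ∈ Finset.range n, l⁻¹ ^ k * Matrix.trace (D.R (g ^ k))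
      = Matrix.trace (M (∑ k ∈ Finset.range n, (l⁻¹ • ρ g) ^ k)) := by
        rw [map_sum, Matrix.trace_sum]
        refine Finset.sum_congr rfl fun k _ => ?_
        rw [hR, Matrix.trace_mul_comm, ← mul_assoc, hCB, one_mul, _root_.smul_pow, map_smul,
          Matrix.trace_smul, map_pow ρ, smul_eq_mul]
    _ = 0 := by rw [hsum, map_zero, Matrix.trace_zero]
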